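/- arXiv:2508.14287 — 3 statements merged into one kernel-verified Lean document; each statement's English description precedes it below -/
import Mathlib

section
/- In any run of the Section-3 algorithm, for every fixed height h, the interval labels of the partial nodes at height h across all elementary trees A_0, A_1, A_2, … are pairwise disjoint. -/
noncomputable section
attribute [local instance] Classical.propDecidable

/-- The state of an elementary tree: nodes are identified with paths from the root
(`false` = left, `true` = right); `label` records the interval `[lo, hi)` labeling a
marked node (`none` = unmarked), and `occ` records the element written in a leaf cell. -/
structure ETState where
  label : List Bool → Option (ℝ × ℝ)
  occ : List Bool → Option ℝ

/-- The initial state of an elementary tree whose root is statically labeled `I`. -/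
def ETState.init (I : ℝ × ℝ) : ETState :=
  ⟨fun p => if p = [] then some I else none, fun _ => none⟩

/-- The half of the interval `I = [lo, hi)` containing `x`. -/
def halfContaining (I : ℝ × ℝ) (x : ℝ) : ℝ × ℝ :=
  if x < (I.1 + I.2) / 2 then (I.1, (I.1 + I.2) / 2) else ((I.1 + I.2) / 2, I.2)

def ETState.setLabel (s : ETState) (p : List Bool) (I : ℝ × ℝ) : ETState :=
  ⟨fun q => if q = p then some I else s.label q, s.occ⟩

def ETState.setOcc (s : ETState) (p : List Bool) (x : ℝ) : ETState :=
  ⟨s.label, fun q => if q = p then some x else s.occ q⟩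

/-- `etInsert d p pl x s` is the recursive procedure `insert(v, x)` at the node `v` with
path `p` and height `d` above the leaves (so leaves have `d = 0`), where `pl` is the label
of `v`'s parent.  It returns the success flag together with the updated state:
* an unmarked leaf gets labeled with the half of `pl` containing `x`, and `x` is written
  into its cell (success); a marked leaf yields failure;
* a marked internal node: failure if `x` is inadmissible, otherwise insert into the left
  child and, if that fails, into the right child;
* an unmarked internal node gets labeled with the half of `pl` containing `x`, and the
  insertion proceeds into its left child. -/
def etInsert : ℕ → List Bool → (ℝ × ℝ) → ℝ → ETState → Bool × ETState
  | 0, p, pl, x, s =>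
    match s.label p with
    | none => (true, (s.setLabel p (halfContaining pl x)).setOcc p x)
    | some _ => (false, s)
  | d + 1, p, pl, x, s =>
    match s.label p with
    | none =>
        let I := halfContaining pl x
        etInsert d (p ++ [false]) I x (s.setLabel p I)
    | some I =>
        if I.1 ≤ x ∧ x < I.2 then
          match etInsert d (p ++ [false]) I x s with
          | (true, s') => (true, s')
          | (false, s') => etInsert d (p ++ [true]) I x s'
        else (false, s)

/-- Insert `x` at the root of an elementary tree of height `h` (the root is always
marked, so the parent label passed along is irrelevant). -/
def etInsertTop (h : ℕ) (x : ℝ) (s : ETState) : Bool × ETState :=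
  etInsert h [] ((s.label []).getD (0, 1)) x s

/-- Insert the elements of `xs` one by one into an elementary tree of height `h` with
root label `I`, returning the conjunction of all success flags and the final state. -/
def etRunAll (h : ℕ) (I : ℝ × ℝ) (xs : List ℝ) : Bool × ETState :=
  xs.foldl (fun acc x =>
    let r := etInsertTop h x acc.2
    (acc.1 && r.1, r.2)) (true, ETState.init I)

/-- The path (of length `h`) of the `i`-th leaf from the left in a tree of height `h`. -/
def pathOfIdx (h i : ℕ) : List Bool :=
  (List.range h).map fun k => Nat.testBit i (h - 1 - k)

/-- One step of the Section-3 algorithm: insert `x` into the first elementary tree (in the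
sequence `f 0, f 1, f 2, …`, all of height `H`) in which the insertion succeeds. -/
def multiInsert (H : ℕ) (x : ℝ) (f : ℕ → ETState) : ℕ → ETState :=
  if h : ∃ k, (etInsertTop H x (f k)).1 = true then
    fun i => if i = Nat.find h then (etInsertTop H x (f (Nat.find h))).2 else f i
  else f

/-- The Section-3 algorithm: starting from a sequence of identical empty elementary trees
of height `H` with roots labeled `[0, 1)`, insert the elements of `xs` one by one, each
into the first tree that accepts it. -/
def sec3Run (H : ℕ) (xs : List ℝ) : ℕ → ETState :=
  xs.foldl (fun f x => multiInsert H x f) fun _ => ETState.init (0, 1)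

namespace S12

def WF (H : ℕ) (s : ETState) : Prop :=
  s.label [] = some (0, 1) ∧
  (∀ p b J, s.label (p ++ [b]) = some J → ∃ L, s.label p = some L ∧
    (J = (L.1, (L.1 + L.2) / 2) ∨ J = ((L.1 + L.2) / 2, L.2))) ∧
  (∀ p, s.label (p ++ [true]) ≠ none → s.label (p ++ [false]) ≠ none) ∧
  (∀ p, p ≠ [] → p.length < H → s.label p ≠ none → s.label (p ++ [false]) ≠ none) ∧
  (∀ p, H < p.length → s.label p = none)

def chainL (x : ℝ) (pl : ℝ × ℝ) : ℕ → ℝ × ℝ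
  | 0 => halfContaining pl x
  | i + 1 => halfContaining (chainL x pl i) x

lemma chainL_shift (x : ℝ) (pl : ℝ × ℝ) (i : ℕ) :
    chainL x (halfContaining pl x) i = chainL x pl (i + 1) := by
  induction i with
  | zero => rfl
  | succ i ih => simp only [chainL] at ih ⊢; rw [ih]

lemma half_cases (I : ℝ × ℝ) (x : ℝ) :
    halfContaining I x = (I.1, (I.1 + I.2) / 2) ∨ halfContaining I x = ((I.1 + I.2) / 2, I.2) := by
  unfold halfContaining; split <;> simp

lemma half_mem (I : ℝ × ℝ) (x : ℝ) (h1 : I.1 ≤ x) (h2 : x < I.2) :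
    (halfContaining I x).1 ≤ x ∧ x < (halfContaining I x).2 := by
  unfold halfContaining; split
  · exact ⟨h1, by assumption⟩
  · exact ⟨by push Not at *; assumption, h2⟩

lemma chainL_mem (x : ℝ) (I : ℝ × ℝ) (h1 : I.1 ≤ x) (h2 : x < I.2) (i : ℕ) :
    (chainL x I i).1 ≤ x ∧ x < (chainL x I i).2 := by
  induction i with
  | zero => exact half_mem I x h1 h2
  | succ i ih => exact half_mem _ x ih.1 ih.2

lemma WF.dyadic {H s} (h : WF H s) (p : List Bool) : ∀ J, s.label p = some J →
    ∃ a : ℕ, J = ((a : ℝ) / 2 ^ p.length, ((a : ℝ) + 1) / 2 ^ p.length) := by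
  induction p using List.reverseRecOn with
  | nil => intro J hJ; rw [h.1] at hJ; refine ⟨0, ?_⟩; simp at hJ; rw [← hJ]; simp
  | append_singleton p b ih =>
    intro J hJ
    obtain ⟨L, hL, hh⟩ := h.2.1 p b J hJ
    obtain ⟨a, rfl⟩ := ih L hL
    rcases hh with rfl | rfl
    · refine ⟨2 * a, ?_⟩
      simp only [List.length_append, List.length_singleton, pow_succ, Prod.mk.injEq]
      constructor <;> (push_cast; field_simp; try ring)
    · refine ⟨2 * a + 1, ?_⟩
      simp only [List.length_append, List.length_singleton, pow_succ, Prod.mk.injEq]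
      constructor <;> (push_cast; field_simp; try ring)

lemma WF.lt {H s} (h : WF H s) {p : List Bool} {J} (hJ : s.label p = some J) : J.1 < J.2 := by
  obtain ⟨a, rfl⟩ := h.dyadic p J hJ
  simp only
  gcongr
  linarith

lemma WF.prefix {H s} (h : WF H s) (p r : List Bool) : ∀ J, s.label (p ++ r) = some J →
    ∃ L, s.label p = some L ∧ L.1 ≤ J.1 ∧ J.2 ≤ L.2 := by
  induction r using List.reverseRecOn with
  | nil => intro J hJ; exact ⟨J, by simpa using hJ, le_rfl, le_rfl⟩
  | append_singleton r b ih =>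
    intro J hJ
    rw [← List.append_assoc] at hJ
    obtain ⟨L, hL, hh⟩ := h.2.1 _ b J hJ
    obtain ⟨M, hM, h1, h2⟩ := ih L hL
    have := h.lt hL
    refine ⟨M, hM, ?_⟩
    rcases hh with rfl | rfl <;> constructor <;> simp only <;> linarith

lemma WF.none_desc {H s} (h : WF H s) (p r : List Bool) (hp : s.label p = none) :
    s.label (p ++ r) = none := by
  by_contra hc
  obtain ⟨J, hJ⟩ := Option.ne_none_iff_exists'.mp hc
  obtain ⟨L, hL, -⟩ := h.prefix p r J hJ
  simp [hL] at hp

lemma WF.prefix' {H s} (h : WF H s) {p q : List Bool} (hpq : p <+: q) {J}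
    (hJ : s.label q = some J) : ∃ L, s.label p = some L ∧ L.1 ≤ J.1 ∧ J.2 ≤ L.2 := by
  obtain ⟨r, rfl⟩ := hpq
  exact h.prefix p r J hJ

lemma WF.none_desc' {H s} (h : WF H s) {p q : List Bool} (hpq : p <+: q)
    (hp : s.label p = none) : s.label q = none := by
  obtain ⟨r, rfl⟩ := hpq
  exact h.none_desc p r hp

def ch (c : List Bool) (i : ℕ) : List Bool := c ++ List.replicate i false

lemma ch_zero (c) : ch c 0 = c := by simp [ch]
lemma ch_succ (c i) : ch c (i + 1) = ch c i ++ [false] := by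
  simp [ch, List.replicate_succ']
lemma ch_succ' (c i) : ch c (i + 1) = ch (c ++ [false]) i := by
  simp [ch, List.replicate_succ]
lemma ch_len (c i) : (ch c i).length = c.length + i := by simp [ch]

def Fill (d : ℕ) (c : List Bool) (pl : ℝ × ℝ) (x : ℝ) (s s' : ETState) : Prop :=
  (∀ q, (∀ i ≤ d, q ≠ ch c i) → s'.label q = s.label q) ∧
  (∀ i ≤ d, s'.label (ch c i) = some (chainL x pl i))

lemma fill_insert (d : ℕ) : ∀ (p : List Bool) (pl : ℝ × ℝ) (x : ℝ) (s : ETState),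
    (∀ i, s.label (ch p i) = none) →
    (etInsert d p pl x s).1 = true ∧ Fill d p pl x s (etInsert d p pl x s).2 := by
  induction d with
  | zero =>
    intro p pl x s hs
    have h0 := hs 0
    rw [ch_zero] at h0
    simp only [etInsert, h0, true_and]
    constructor
    · intro q hq
      have := hq 0 le_rfl
      rw [ch_zero] at this
      simp [ETState.setLabel, ETState.setOcc, this]
    · intro i hi
      obtain rfl : i = 0 := by omega
      simp [ch_zero, ETState.setLabel, ETState.setOcc, chainL]
  | succ d ih =>
    intro p pl x s hs
    have h0 := hs 0
    rw [ch_zero] at h0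
    simp only [etInsert, h0]
    have key := ih (p ++ [false]) (halfContaining pl x) x (s.setLabel p (halfContaining pl x)) ?_
    · obtain ⟨h1, h2, h3⟩ := key
      refine ⟨h1, ?_, ?_⟩
      · intro q hq
        rw [h2 q]
        · have := hq 0 (by omega)
          rw [ch_zero] at this
          simp [ETState.setLabel, this]
        · intro i hi
          have := hq (i + 1) (by omega)
          rwa [ch_succ'] at this
      · intro i hi
        cases i with
        | zero =>
          rw [h2]
          · simp [ch_zero, ETState.setLabel, chainL]
          · intro i hi he
            have := congrArg List.length he
            simp [ch_len] at this
            omega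
        | succ i => rw [ch_succ', h3 i (by omega), chainL_shift]
    · intro i
      have := hs (i + 1)
      rw [ch_succ'] at this
      have hne : ch (p ++ [false]) i ≠ p := by
        intro he
        have := congrArg List.length he
        simp [ch_len] at this
        omega
      simp [ETState.setLabel, this, hne]

/-- no open admissible node in subtree at `p` -/
def NoOpen (H : ℕ) (x : ℝ) (s : ETState) (p : List Bool) : Prop :=
  ∀ q L, p <+: q → q.length < H → s.label q = some L → L.1 ≤ x → x < L.2 →
    s.label (q ++ [true]) ≠ none

def Succ (H : ℕ) (x : ℝ) (s s' : ETState) (p : List Bool) : Prop :=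
  ∃ w b L, p <+: w ∧ s.label w = some L ∧ L.1 ≤ x ∧ x < L.2 ∧ w.length < H ∧
    s.label (w ++ [b]) = none ∧ (b = true → s.label (w ++ [false]) ≠ none) ∧
    Fill (H - w.length - 1) (w ++ [b]) L x s s' ∧
    ∀ u, p <+: u → u ++ [true] <+: w ++ [b] → NoOpen H x s (u ++ [false])

lemma prefix_step {p q : List Bool} (h : p <+: q) (hne : p ≠ q) : ∃ b, p ++ [b] <+: q := by
  obtain ⟨r, rfl⟩ := h
  cases r with
  | nil => simp at hne
  | cons b r => exact ⟨b, r, by simp⟩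

lemma prefix_conflict {u q : List Bool} (h1 : u ++ [false] <+: q) (h2 : u ++ [true] <+: q) :
    False := by
  obtain ⟨r, rfl⟩ := h1
  simp at h2

lemma insert_spec (H d : ℕ) : ∀ (p : List Bool) (pl : ℝ × ℝ) (x : ℝ) (s : ETState),
    WF H s → p.length + d = H → s.label p ≠ none →
    ((etInsert d p pl x s).1 = false → (etInsert d p pl x s).2 = s ∧ NoOpen H x s p) ∧
    ((etInsert d p pl x s).1 = true → Succ H x s (etInsert d p pl x s).2 p) := by
  induction d with
  | zero =>
    intro p pl x s hs hd hp
    obtain ⟨I, hI⟩ := Option.ne_none_iff_exists'.mp hp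
    simp only [etInsert, hI]
    refine ⟨fun _ => ⟨by trivial, ?_⟩, by simp⟩
    intro q L hq hl
    have := hq.length_le
    omega
  | succ d ih =>
    intro p pl x s hs hd hp
    obtain ⟨I, hI⟩ := Option.ne_none_iff_exists'.mp hp
    by_cases hx : I.1 ≤ x ∧ x < I.2
    swap
    · simp only [etInsert, hI, hx, if_false]
      refine ⟨fun _ => ⟨by trivial, ?_⟩, by simp⟩
      intro q L hq hl hL h1 h2
      obtain ⟨M, hM, h3, h4⟩ := hs.prefix' hq hL
      rw [hI] at hM
      obtain rfl : I = M := by simpa using hM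
      exact absurd ⟨by linarith, by linarith⟩ hx
    have hdd : H - p.length - 1 = d := by omega
    by_cases hl : s.label (p ++ [false]) = none
    · obtain ⟨h1, h2⟩ := fill_insert d (p ++ [false]) I x s (fun i => hs.none_desc _ _ hl)
      have e : etInsert (d + 1) p pl x s = etInsert d (p ++ [false]) I x s := by
        simp only [etInsert, hI, hx, and_self, if_true]
        rcases hr : etInsert d (p ++ [false]) I x s with ⟨b, s'⟩
        rw [hr] at h1
        simp only at h1
        subst h1
        rfl
      rw [e]
      refine ⟨fun h => by simp [h1] at h, fun _ => ?_⟩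
      refine ⟨p, false, I, List.prefix_rfl, hI, hx.1, hx.2, by omega, hl, by simp, ?_, ?_⟩
      · rw [hdd]; exact h2
      · intro u hu hut
        exfalso
        have a1 := hut.length_le
        have a2 := hu.length_le
        have : u = p := (hu.eq_of_length (by simp at a1; omega)).symm
        subst this
        simp at hut
    · obtain ⟨f1, t1⟩ := ih (p ++ [false]) I x s hs (by simp; omega) hl
      rcases hr : etInsert d (p ++ [false]) I x s with ⟨b, s'⟩
      rw [hr] at f1 t1
      cases b with
      | true =>
        have e : etInsert (d + 1) p pl x s = (true, s') := by
          simp only [etInsert, hI, hx, and_self, if_true, hr]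
        rw [e]
        refine ⟨by simp, fun _ => ?_⟩
        obtain ⟨w, b, L, g1, g2, g3, g4, g5, g6, g7, g8, g9⟩ := t1 rfl
        refine ⟨w, b, L, (List.prefix_append _ _).trans g1, g2, g3, g4, g5, g6, g7, g8, ?_⟩
        intro u hu hut
        by_cases hup : p = u
        · subst hup
          exact (prefix_conflict (g1.trans (List.prefix_append _ _)) hut).elim
        · obtain ⟨c, hc⟩ := prefix_step hu hup
          cases c with
          | false => exact g9 u hc hut
          | true =>
            exact (prefix_conflict (g1.trans (List.prefix_append _ _))
              (hc.trans ((List.prefix_append _ _).trans hut))).elim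
      | false =>
        obtain ⟨e0, no⟩ := f1 rfl
        simp only at e0
        subst e0
        have e : etInsert (d + 1) p pl x s' = etInsert d (p ++ [true]) I x s' := by
          simp only [etInsert, hI, hx, and_self, if_true, hr]
        rw [e]
        by_cases hrt : s'.label (p ++ [true]) = none
        · obtain ⟨h1, h2⟩ := fill_insert d (p ++ [true]) I x s' (fun i => hs.none_desc _ _ hrt)
          refine ⟨fun h => by simp [h1] at h, fun _ => ?_⟩
          refine ⟨p, true, I, List.prefix_rfl, hI, hx.1, hx.2, by omega, hrt, fun _ => hl, ?_, ?_⟩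
          · rw [hdd]; exact h2
          · intro u hu hut
            have a1 := hut.length_le
            have a2 := hu.length_le
            have : u = p := (hu.eq_of_length (by simp at a1; omega)).symm
            subst this
            exact no
        · obtain ⟨f2, t2⟩ := ih (p ++ [true]) I x s' hs (by simp; omega) hrt
          constructor
          · intro hf
            obtain ⟨e2, no2⟩ := f2 hf
            refine ⟨e2, ?_⟩
            intro q L hq
            by_cases hpq : p = q
            · subst hpq
              intros
              exact hrt
            · obtain ⟨c, hc⟩ := prefix_step hq hpq
              cases c with
              | false => exact no q L hc
              | true => exact no2 q L hc
          · intro ht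
            obtain ⟨w, b, L, g1, g2, g3, g4, g5, g6, g7, g8, g9⟩ := t2 ht
            refine ⟨w, b, L, (List.prefix_append _ _).trans g1, g2, g3, g4, g5, g6, g7, g8, ?_⟩
            intro u hu hut
            by_cases hup : p = u
            · subst hup
              exact no
            · obtain ⟨c, hc⟩ := prefix_step hu hup
              cases c with
              | true => exact g9 u hc hut
              | false =>
                exact (prefix_conflict (hc.trans ((List.prefix_append _ _).trans hut))
                  (g1.trans (List.prefix_append _ _))).elim

section step
variable {H : ℕ} {x : ℝ} {s s' : ETState} {w : List Bool} {b : Bool} {L : ℝ × ℝ}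

lemma fill_mono (hs : WF H s) (hn : s.label (w ++ [b]) = none)
    (hF : Fill (H - w.length - 1) (w ++ [b]) L x s s') {q J} (hq : s.label q = some J) :
    s'.label q = some J := by
  rw [hF.1 q, hq]
  rintro i hi rfl
  have := hs.none_desc _ (List.replicate i false) hn
  simp only [ch] at hq
  rw [hq] at this
  simp at this

lemma fill_mono' (hs : WF H s) (hn : s.label (w ++ [b]) = none)
    (hF : Fill (H - w.length - 1) (w ++ [b]) L x s s') {q} (hq : s.label q ≠ none) :
    s'.label q ≠ none := by
  obtain ⟨J, hJ⟩ := Option.ne_none_iff_exists'.mp hq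
  rw [fill_mono hs hn hF hJ]
  simp

lemma fill_wf (hs : WF H s) (hw : s.label w = some L) (hwH : w.length < H)
    (hn : s.label (w ++ [b]) = none) (hb : b = true → s.label (w ++ [false]) ≠ none)
    (hF : Fill (H - w.length - 1) (w ++ [b]) L x s s') : WF H s' := by
  have mono : ∀ {q}, s.label q ≠ none → s'.label q ≠ none := fun h => fill_mono' hs hn hF h
  refine ⟨fill_mono hs hn hF hs.1, ?_, ?_, ?_, ?_⟩
  · intro p c J hJ
    by_cases hc : ∃ i ≤ H - w.length - 1, p ++ [c] = ch (w ++ [b]) i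
    · obtain ⟨i, hi, e⟩ := hc
      rw [e, hF.2 i hi] at hJ
      cases i with
      | zero =>
        rw [ch_zero] at e
        obtain ⟨rfl, -⟩ := List.append_inj' e rfl
        refine ⟨L, fill_mono hs hn hF hw, ?_⟩
        simp only [chainL, Option.some.injEq] at hJ
        rw [← hJ]
        exact half_cases L x
      | succ i =>
        rw [ch_succ] at e
        obtain ⟨rfl, -⟩ := List.append_inj' e rfl
        refine ⟨_, hF.2 i (by omega), ?_⟩
        simp only [chainL, Option.some.injEq] at hJ
        rw [← hJ]
        exact half_cases _ x
    · push Not at hc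
      rw [hF.1 _ hc] at hJ
      obtain ⟨M, hM, hh⟩ := hs.2.1 p c J hJ
      exact ⟨M, fill_mono hs hn hF hM, hh⟩
  · intro p hp
    by_cases hc : ∃ i ≤ H - w.length - 1, p ++ [true] = ch (w ++ [b]) i
    · obtain ⟨i, hi, e⟩ := hc
      cases i with
      | zero =>
        rw [ch_zero] at e
        obtain ⟨rfl, e2⟩ := List.append_inj' e rfl
        simp at e2
        exact mono (hb (by simp [e2]))
      | succ i =>
        rw [ch_succ] at e
        obtain ⟨rfl, e2⟩ := List.append_inj' e rfl
        simp at e2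
    · push Not at hc
      rw [hF.1 _ hc] at hp
      exact mono (hs.2.2.1 p hp)
  · intro p hp0 hpH hp
    by_cases hc : ∃ i ≤ H - w.length - 1, p = ch (w ++ [b]) i
    · obtain ⟨i, hi, rfl⟩ := hc
      rw [← ch_succ, hF.2]
      · simp
      · simp [ch_len] at hpH
        omega
    · push Not at hc
      rw [hF.1 _ hc] at hp
      exact mono (hs.2.2.2.1 p hp0 hpH hp)
  · intro p hp
    rw [hF.1, hs.2.2.2.2 p hp]
    rintro i hi rfl
    simp [ch_len] at hp
    omega

end step

def Before (k' : ℕ) (p' : List Bool) (k : ℕ) (p : List Bool) : Prop :=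
  k' < k ∨ (k' = k ∧ ∃ u, u ++ [false] <+: p' ∧ u ++ [true] <+: p)

def Good (H : ℕ) (f : ℕ → ETState) : Prop :=
  (∀ k, WF H (f k)) ∧ ∀ k p J k' p' J', Before k' p' k p → p'.length ≤ p.length → p.length < H →
    (f k).label p = some J → (f k).label (p ++ [false]) ≠ none → (f k').label p' = some J' →
    J'.1 ≤ J.1 → J.2 ≤ J'.2 → (f k').label (p' ++ [true]) ≠ none

lemma ch_prefix (c : List Bool) {i j : ℕ} (h : i ≤ j) : ch c i <+: ch c j := by
  obtain ⟨m, rfl⟩ := Nat.exists_eq_add_of_le h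
  exact ⟨List.replicate m false, by simp [ch]⟩

lemma true_prefix_ch {u c : List Bool} : ∀ {i : ℕ}, u ++ [true] <+: ch c i → u ++ [true] <+: c := by
  intro i
  induction i with
  | zero => rw [ch_zero]; exact id
  | succ i ih =>
    intro h
    rw [ch_succ, List.prefix_concat_iff] at h
    rcases h with h | h
    · have := (List.append_inj' h rfl).2
      simp at this
    · exact ih h

lemma good_step {H x f} (hG : Good H f) : Good H (multiInsert H x f) := by
  unfold multiInsert
  split
  swap
  · exact hG
  rename_i hex
  obtain ⟨hW, hO⟩ := hG
  have hroot : ∀ k, (f k).label [] ≠ none := fun k => by rw [(hW k).1]; simp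
  have hspec := fun k => insert_spec H H [] (((f k).label []).getD (0, 1)) x (f k) (hW k)
    (by simp) (hroot k)
  have hmin : ∀ k < Nat.find hex, NoOpen H x (f k) [] := by
    intro k hk
    have := Nat.find_min hex hk
    exact ((hspec k).1 (by simpa [etInsertTop] using this)).2
  have hsucc := (hspec (Nat.find hex)).2 (Nat.find_spec hex)
  change Succ H x _ (etInsertTop H x (f (Nat.find hex))).2 [] at hsucc
  generalize (etInsertTop H x (f (Nat.find hex))).2 = s' at hsucc ⊢
  generalize Nat.find hex = k0 at *
  clear hspec
  obtain ⟨w, b, L, -, hw, hx1, hx2, hwH, hn, hb, hF, hno⟩ := hsucc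
  have hwf' := fill_wf (hW k0) hw hwH hn hb hF
  set f' : ℕ → ETState := fun i => if i = k0 then s' else f i with hf'
  have f'0 : f' k0 = s' := by simp [hf']
  have f'n : ∀ k, k ≠ k0 → f' k = f k := fun k hk => by simp [hf', hk]
  have hW' : ∀ k, WF H (f' k) := by
    intro k
    by_cases hk : k = k0
    · subst hk; rw [f'0]; exact hwf'
    · rw [f'n k hk]; exact hW k
  have mono : ∀ k q J, (f k).label q = some J → (f' k).label q = some J := by
    intro k q J h
    by_cases hk : k = k0
    · subst hk; rw [f'0]; exact fill_mono (hW k) hn hF h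
    · rw [f'n k hk]; exact h
  -- new nodes
  have new : ∀ k q, (f k).label q = none → (f' k).label q ≠ none →
      k = k0 ∧ ∃ i ≤ H - w.length - 1, q = ch (w ++ [b]) i := by
    intro k q h1 h2
    by_cases hk : k = k0
    · subst hk
      refine ⟨rfl, ?_⟩
      by_contra hc
      push Not at hc
      rw [f'0, hF.1 q hc] at h2
      exact h2 h1
    · rw [f'n k hk] at h2
      exact absurd h1 h2
  have hwt : (f k0).label (w ++ [true]) = none := by
    by_contra hc
    cases b with
    | true => exact hc hn
    | false => exact (hW k0).2.2.1 w hc hn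
  refine ⟨hW', ?_⟩
  intro k p J k' p' J' hB hlen hpH hJ hpl hJ' hle1 hle2 hopen'
  have hopen : (f k').label (p' ++ [true]) = none := by
    by_contra hc
    obtain ⟨M, hM⟩ := Option.ne_none_iff_exists'.mp hc
    rw [mono _ _ _ hM] at hopen'
    simp at hopen'
  by_cases hold : (f k).label (p ++ [false]) = none
  · obtain ⟨rfl, i, hi, hpi⟩ := new k _ hold hpl
    -- x in J
    have hxJ : J.1 ≤ x ∧ x < J.2 := by
      have e := hF.2 i hi
      rw [← hpi, ← f'0] at e
      obtain ⟨M, hM, h1, h2⟩ := (hW' k).prefix _ _ _ e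
      rw [hJ] at hM
      obtain rfl : J = M := by simpa using hM
      have := chainL_mem x L hx1 hx2 i
      constructor <;> linarith
    rcases hB with hlt | ⟨rfl, u, hu1, hu2⟩
    · rw [f'n k' (by omega)] at hJ'
      exact hmin k' hlt p' J' (List.nil_prefix) (by omega) hJ' (by linarith) (by linarith) hopen
    · have hpp : p <+: ch (w ++ [b]) i := by rw [← hpi]; exact List.prefix_append _ _
      by_cases hp'n : (f k').label p' = none
      · obtain ⟨-, j, hj, rfl⟩ := new k' p' hp'n (by rw [hJ']; simp)
        exact prefix_conflict (hu1.trans (ch_prefix _ (le_max_right i j)))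
          (hu2.trans (hpp.trans (ch_prefix _ (le_max_left i j))))
      · obtain ⟨M, hM⟩ := Option.ne_none_iff_exists'.mp hp'n
        have := mono _ _ _ hM
        rw [hJ'] at this
        obtain rfl : J' = M := by simpa using this
        exact hno u List.nil_prefix (true_prefix_ch (hu2.trans hpp)) p' J' hu1 (by omega) hM
          (by linarith) (by linarith) hopen
  · have hpold : (f k).label p = some J := by
      obtain ⟨M, hM⟩ := Option.ne_none_iff_exists'.mp hold
      obtain ⟨N, hN, -⟩ := (hW k).prefix _ _ _ hM
      have := mono _ _ _ hN
      rw [hJ] at this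
      rw [hN, this]
    by_cases hp'n : (f k').label p' = none
    · obtain ⟨rfl, j, hj, rfl⟩ := new k' p' hp'n (by rw [hJ']; simp)
      have hwp : w <+: ch (w ++ [b]) j := by simp [ch]
      obtain ⟨M, hM, m1, m2⟩ := (hW' k').prefix' hwp hJ'
      rw [mono _ _ _ hw] at hM
      obtain rfl : L = M := by simpa using hM
      refine hO k p J k' w L ?_ (hwp.length_le.trans hlen) hpH hpold hold hw (by linarith)
        (by linarith) hwt
      rcases hB with hlt | ⟨rfl, u, hu1, hu2⟩
      · exact Or.inl hlt
      · refine Or.inr ⟨rfl, u, ?_, hu2⟩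
        obtain ⟨M, hM, -⟩ := (hW k').prefix' hu2 hpold
        have hul := (hW k').2.2.1 u (by rw [hM]; simp)
        rcases List.prefix_or_prefix_of_prefix hu1 hwp with h | h
        · exact h
        · by_cases he : w = u ++ [false]
          · rw [he]
          · exfalso
            obtain ⟨c, hc⟩ := prefix_step h he
            have h3 : w ++ [b] <+: ch (w ++ [b]) j := by simp [ch]
            have h4 := List.prefix_of_prefix_length_le h3 hu1 (by
              have := hc.length_le; simpa using this)
            exact hul ((hW k').none_desc' h4 hn)
    · obtain ⟨M, hM⟩ := Option.ne_none_iff_exists'.mp hp'n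
      have := mono _ _ _ hM
      rw [hJ'] at this
      obtain rfl : J' = M := by simpa using this
      exact hO k p J k' p' J' hB hlen hpH hpold hold hM hle1 hle2 hopen

lemma good_init (H : ℕ) : Good H (fun _ => ETState.init (0, 1)) := by
  refine ⟨fun _ => ⟨?_, ?_, ?_, ?_, ?_⟩, ?_⟩
  · simp [ETState.init]
  · simp [ETState.init]
  · simp [ETState.init]
  · intro p hp; simp [ETState.init, hp]
  · intro p hp
    have : p ≠ [] := by rintro rfl; simp at hp
    simp [ETState.init, this]
  · intro k p J k' p' J' _ _ _ _ h
    simp [ETState.init] at h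

lemma good_run (H : ℕ) (xs : List ℝ) : Good H (sec3Run H xs) := by
  unfold sec3Run
  have : ∀ f, Good H f → Good H (xs.foldl (fun f x => multiInsert H x f) f) := by
    induction xs with
    | nil => intro f hf; exact hf
    | cons x xs ih => intro f hf; exact ih _ (good_step hf)
  exact this _ (good_init H)

lemma lex_total (p p' : List Bool) (hl : p.length = p'.length) (hne : p ≠ p') :
    ∃ u, (u ++ [false] <+: p ∧ u ++ [true] <+: p') ∨ (u ++ [false] <+: p' ∧ u ++ [true] <+: p) := by
  induction p generalizing p' with
  | nil => cases p' <;> simp_all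
  | cons a p ih =>
    cases p' with
    | nil => simp at hl
    | cons a' p' =>
      by_cases h : a = a'
      · subst h
        obtain ⟨u, hu⟩ := ih p' (by simpa using hl) (by simpa using hne)
        exact ⟨a :: u, by simpa using hu⟩
      · refine ⟨[], ?_⟩
        cases a <;> cases a' <;> simp_all

lemma partial_false {H f} (hG : Good H f) {k k' p p' J} (hl : p'.length = p.length)
    (hB : Before k' p' k p)
    (hpart : Xor' ((f k).label (p ++ [false]) = none) ((f k).label (p ++ [true]) = none))
    (hpart' : Xor' ((f k').label (p' ++ [false]) = none) ((f k').label (p' ++ [true]) = none))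
    (hJ : (f k).label p = some J) (hJ' : (f k').label p' = some J) : False := by
  have hW := hG.1
  have h1 : (f k).label (p ++ [false]) ≠ none := by
    rcases hpart with ⟨_, h⟩ | ⟨_, h⟩
    · exact (hW k).2.2.1 p h
    · exact h
  have h2 : (f k').label (p' ++ [true]) = none := by
    rcases hpart' with ⟨h, h'⟩ | ⟨h, _⟩
    · exact absurd h ((hW k').2.2.1 p' h')
    · exact h
  have h3 : p.length < H := by
    by_contra hc
    exact h1 ((hW k).2.2.2.2 _ (by simp; omega))
  exact hG.2 k p J k' p' J hB hl.le h3 hJ h1 hJ' le_rfl le_rfl h2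

end S12

/-!
STATEMENT 12: in any run of the Section-3 algorithm (a sequence of elementary trees
`A 0, A 1, …` of height `H = ⌊log₂(ε n) − log₂ log₂ n⌋` with roots labeled `[0,1)`, each
element being inserted into the first tree that accepts it), for every fixed height `h` the
interval labels of the partial nodes at height `h` — the non-leaf nodes having exactly one
empty (unmarked) child — across all the trees are pairwise disjoint.
-/
theorem statement12 (n : ℕ) (hn : 2 ≤ n) (ε : ℝ)
    (hε₁ : Real.logb 2 n / n ≤ ε) (hε₂ : ε ≤ 1)
    (xs : List ℝ) (hxs : ∀ x ∈ xs, x ∈ Set.Ico (0 : ℝ) 1)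
    (H : ℕ) (hH : H = ⌊Real.logb 2 (ε * n) - Real.logb 2 (Real.logb 2 n)⌋₊)
    (h k k' : ℕ) (p p' : List Bool)
    (hp : p.length + h = H) (hp' : p'.length + h = H)
    (hpart : Xor' ((sec3Run H xs k).label (p ++ [false]) = none)
                  ((sec3Run H xs k).label (p ++ [true]) = none))
    (hpart' : Xor' ((sec3Run H xs k').label (p' ++ [false]) = none)
                   ((sec3Run H xs k').label (p' ++ [true]) = none))
    (hne : (k, p) ≠ (k', p'))
    (J J' : ℝ × ℝ)
    (hJ : (sec3Run H xs k).label p = some J)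
    (hJ' : (sec3Run H xs k').label p' = some J') :
    Disjoint (Set.Ico J.1 J.2) (Set.Ico J'.1 J'.2) := by
  have hG := S12.good_run H xs
  have hl : p'.length = p.length := by omega
  by_cases hJJ : J = J'
  · exfalso
    subst hJJ
    rcases lt_trichotomy k k' with hk | rfl | hk
    · exact S12.partial_false hG hl.symm (Or.inl hk) hpart' hpart hJ' hJ
    · have hpp : p ≠ p' := by rintro rfl; exact hne rfl
      obtain ⟨u, hu | hu⟩ := S12.lex_total p p' hl.symm hpp
      · exact S12.partial_false hG hl.symm (Or.inr ⟨rfl, u, hu⟩) hpart' hpart hJ' hJ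
      · exact S12.partial_false hG hl (Or.inr ⟨rfl, u, hu⟩) hpart hpart' hJ hJ'
    · exact S12.partial_false hG hl (Or.inl hk) hpart hpart' hJ hJ'
  · obtain ⟨a, rfl⟩ := (hG.1 k).dyadic p J hJ
    obtain ⟨a', rfl⟩ := (hG.1 k').dyadic p' J' hJ'
    rw [hl] at hJJ ⊢
    rw [Set.disjoint_left]
    rintro y ⟨y1, y2⟩ ⟨y3, y4⟩
    apply hJJ
    have hpos : (0 : ℝ) < 2 ^ p.length := by positivity
    simp only [div_le_iff₀ hpos, lt_div_iff₀ hpos] at y1 y2 y3 y4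
    have e1 : (a : ℝ) < a' + 1 := by linarith
    have e2 : (a' : ℝ) < a + 1 := by linarith
    have e3 : a < a' + 1 := by exact_mod_cast e1
    have e4 : a' < a + 1 := by exact_mod_cast e2
    have : a = a' := by omega
    rw [this]

end
end

section
/- In the Section-3 algorithm with log₂ n/n ≤ ε ≤ 1 applied to a sequence of at most n elements of [0,1), at every point in time the total number of empty array cells across the elementary trees that contain at least one element is at most ε·n; consequently, after all n elements are inserted, the total number of array cells in the non-empty trees is at most (1+ε)·n. -/
noncomputable section
attribute [local instance] Classical.propDecidable

/-- The number of empty (unoccupied) leaf cells of an elementary tree of height `H`. -/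
def emptyCellCount (H : ℕ) (s : ETState) : ℕ :=
  (Finset.univ.filter fun i : Fin (2 ^ H) => s.occ (pathOfIdx H i.1) = none).card

/-- An elementary tree of height `H` contains at least one element. -/
def treeNonempty (H : ℕ) (s : ETState) : Prop :=
  ∃ i : Fin (2 ^ H), s.occ (pathOfIdx H i.1) ≠ none

def dy (k : ℕ) (x : ℝ) : ℝ × ℝ :=
  ((⌊(2:ℝ)^k * x⌋ : ℝ) / 2^k, ((⌊(2:ℝ)^k * x⌋ : ℝ) + 1) / 2^k)

theorem mem_dy (k : ℕ) (x y : ℝ) :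
    ((dy k y).1 ≤ x ∧ x < (dy k y).2) ↔ dy k x = dy k y := by
  have h2 : (0:ℝ) < 2^k := by positivity
  have e1 : ((dy k y).1 ≤ x ∧ x < (dy k y).2) ↔ ⌊(2:ℝ)^k * x⌋ = ⌊(2:ℝ)^k * y⌋ := by
    rw [Int.floor_eq_iff]
    simp only [dy]
    rw [div_le_iff₀ h2, lt_div_iff₀ h2, mul_comm x]
  rw [e1]
  constructor
  · intro h
    simp [dy, h]
  · intro h
    have := congrArg Prod.fst h
    simp only [dy] at this
    rw [div_left_inj' h2.ne'] at this
    exact_mod_cast this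

theorem dy_floor {k : ℕ} {x y : ℝ} (h : ⌊(2:ℝ)^k * x⌋ = ⌊(2:ℝ)^k * y⌋) : dy k x = dy k y := by
  simp [dy, h]

theorem half_dy (k : ℕ) (x : ℝ) : halfContaining (dy k x) x = dy (k+1) x := by
  have h2 : (0:ℝ) < 2^k := by positivity
  have hm := (mem_dy k x x).2 rfl
  simp only [dy] at hm
  rw [div_le_iff₀ h2, lt_div_iff₀ h2, mul_comm x] at hm
  unfold halfContaining
  set a : ℤ := ⌊(2:ℝ)^k * x⌋ with ha
  have hmid : ((dy k x).1 + (dy k x).2) / 2 = (2 * a + 1) / 2^(k+1) := by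
    simp only [dy, ← ha]
    field_simp
    ring
  rw [hmid]
  have h3 : (0:ℝ) < 2^(k+1) := by positivity
  split_ifs with h
  · rw [lt_div_iff₀ h3, pow_succ] at h
    have : ⌊(2:ℝ)^(k+1) * x⌋ = 2 * a := by
      rw [Int.floor_eq_iff]; push_cast; rw [pow_succ]
      constructor <;> nlinarith
    simp only [dy, this, ← ha]
    push_cast
    congr 1
    field_simp
    ring
  · rw [not_lt, div_le_iff₀ h3, pow_succ] at h
    have : ⌊(2:ℝ)^(k+1) * x⌋ = 2 * a + 1 := by
      rw [Int.floor_eq_iff]; push_cast; rw [pow_succ]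
      constructor <;> nlinarith
    simp only [dy, this, ← ha]
    push_cast
    congr 1
    field_simp
    ring

theorem dy_nest {k : ℕ} {x y : ℝ} (h : dy (k+1) x = dy (k+1) y) : dy k x = dy k y := by
  have h1 := (mem_dy _ _ _).2 h
  rw [← mem_dy]
  rw [← half_dy] at h1
  have hlt : (dy k y).1 < (dy k y).2 := by
    have := (mem_dy k y y).2 rfl
    linarith
  unfold halfContaining at h1
  split_ifs at h1 <;> simp only at h1 <;> constructor <;> linarith [h1.1, h1.2]

theorem dy_zero {x : ℝ} (h : x ∈ Set.Ico (0:ℝ) 1) : dy 0 x = (0, 1) := by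
  have : ⌊x⌋ = 0 := by rw [Int.floor_eq_iff]; simpa using h
  simp [dy, this]

def WF (s : ETState) : Prop :=
  s.label [] = some (0, 1) ∧ ∀ t b J, s.label (t ++ [b]) = some J →
    ∃ y ∈ Set.Ico (0:ℝ) 1, J = dy (t.length + 1) y ∧ s.label t = some (dy t.length y)

theorem WF.exists_y {s : ETState} (hs : WF s) {t : List Bool} {J} (h : s.label t = some J) :
    ∃ y ∈ Set.Ico (0:ℝ) 1, J = dy t.length y := by
  rcases List.eq_nil_or_concat t with rfl | ⟨t, b, rfl⟩
  · rw [hs.1] at h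
    refine ⟨0, by simp, ?_⟩
    simp [dy_zero] at h ⊢
    exact h.symm
  · simp only [List.concat_eq_append] at *
    obtain ⟨y, hy, h1, -⟩ := hs.2 _ _ _ h
    exact ⟨y, hy, by simpa using h1⟩

theorem WF.nest {s : ETState} (hs : WF s) (p c : List Bool) (y : ℝ)
    (h : s.label (p ++ c) = some (dy (p ++ c).length y)) : s.label p = some (dy p.length y) := by
  induction c using List.reverseRecOn with
  | nil => simpa using h
  | append_singleton c b ih =>
    apply ih
    rw [← List.append_assoc] at h
    obtain ⟨z, hz, h1, h2⟩ := hs.2 _ _ _ h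
    rw [h2]
    rw [List.length_append (bs := [b])] at h1
    rw [dy_nest h1]

theorem WF.marked {s : ETState} (hs : WF s) (p c : List Bool)
    (h : s.label (p ++ c) ≠ none) : s.label p ≠ none := by
  obtain ⟨J, hJ⟩ := Option.ne_none_iff_exists'.1 h
  obtain ⟨y, hy, rfl⟩ := hs.exists_y hJ
  rw [hs.nest p c y hJ]; simp

def Chain (d : ℕ) (p : List Bool) (x : ℝ) (s s' : ETState) : Prop :=
  (∀ t, s'.label t = if ∃ i ≤ d, t = p ++ List.replicate i false then some (dy t.length x)
    else s.label t) ∧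
  (∀ t, s'.occ t = if t = p ++ List.replicate d false then some x else s.occ t)

theorem insert_unmarked (d : ℕ) : ∀ (p : List Bool) (k : ℕ) (x : ℝ) (s : ETState),
    p.length = k + 1 → (∀ c, s.label (p ++ c) = none) →
    (etInsert d p (dy k x) x s).1 = true ∧ Chain d p x s (etInsert d p (dy k x) x s).2 := by
  induction d with
  | zero =>
    intro p k x s hp hc
    have h0 : s.label p = none := by simpa using hc []
    simp only [etInsert, h0, half_dy, ETState.setLabel, ETState.setOcc, Chain]
    simp only [true_and]
    refine ⟨fun t => ?_, fun t => ?_⟩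
    · by_cases ht : t = p
      · subst ht; simp [hp]
      · simp [ht]
    · by_cases ht : t = p <;> simp [ht]
  | succ d ih =>
    intro p k x s hp hc
    have h0 : s.label p = none := by simpa using hc []
    simp only [etInsert, h0, half_dy]
    obtain ⟨h1, h2, h3⟩ := ih (p ++ [false]) (k+1) x (s.setLabel p (dy (k+1) x)) (by simp [hp])
      (by intro c; simp [ETState.setLabel]; simpa using hc (false :: c))
    refine ⟨h1, fun t => ?_, fun t => ?_⟩
    · rw [h2]
      by_cases ht : t = p
      · subst ht
        rw [if_neg, if_pos ⟨0, by simp⟩]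
        · simp [ETState.setLabel, hp]
        · rintro ⟨i, -, h⟩
          have := congrArg List.length h
          simp at this
          
      · simp only [ETState.setLabel, ht, if_false]
        congr 1
        apply propext
        constructor
        · rintro ⟨i, hi, rfl⟩
          exact ⟨i+1, by omega, by simp [List.replicate_succ]⟩
        · rintro ⟨i, hi, rfl⟩
          cases i with
          | zero => simp at ht
          | succ i => exact ⟨i, by omega, by simp [List.replicate_succ]⟩
    · rw [h3]
      simp [ETState.setLabel, List.replicate_succ]

theorem insert_fail (d : ℕ) : ∀ (p : List Bool) (k : ℕ) (x : ℝ) (s s' : ETState), WF s →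
    (p = [] ∨ p.length = k + 1) → x ∈ Set.Ico (0:ℝ) 1 →
    etInsert d p (dy k x) x s = (false, s') → s' = s ∧ s.label p ≠ none ∧
      ∀ c, c.length < d → s.label (p ++ c) = some (dy (p ++ c).length x) →
        ∀ b, s.label (p ++ c ++ [b]) ≠ none := by
  induction d with
  | zero =>
    intro p k x s s' hs hp hx h
    simp only [etInsert] at h
    cases hl : s.label p with
    | none => simp [hl] at h
    | some I => simp [hl] at h; simp [h]
  | succ d ih =>
    intro p k x s s' hs hp hx h
    cases hl : s.label p with
    | none =>
      rcases hp with rfl | hp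
      · rw [hs.1] at hl; simp at hl
      have := (insert_unmarked (d+1) p k x s hp (by
        intro c; by_contra hc; exact hs.marked _ _ hc hl)).1
      rw [h] at this; simp at this
    | some I =>
      obtain ⟨y, hy, rfl⟩ := hs.exists_y hl
      simp only [etInsert, hl, mem_dy] at h
      split_ifs at h with hI
      · rw [← hI] at h hl
        rcases hE : etInsert d (p ++ [false]) (dy p.length x) x s with ⟨b1, s1⟩
        rw [hE] at h
        cases b1 with
        | true => simp at h
        | false =>
          simp only at h
          obtain ⟨rfl, hm1, hf1⟩ := ih _ _ _ _ _ hs (by simp) hx hE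
          obtain ⟨rfl, hm2, hf2⟩ := ih _ _ _ _ _ hs (by simp) hx h
          refine ⟨rfl, by simp, ?_⟩
          intro c hc hlc b
          cases c with
          | nil => cases b <;> simpa
          | cons e c =>
            simp only [List.length_cons] at hc
            cases e
            · have := hf1 c (by omega) (by simpa using hlc) b
              simpa using this
            · have := hf2 c (by omega) (by simpa using hlc) b
              simpa using this
      · simp at h
        refine ⟨h.symm, by simp, ?_⟩
        intro c hc hlc b
        have := hs.nest _ _ _ hlc
        rw [hl] at this
        simp at this
        exact absurd this.symm hI

theorem insert_succ (d : ℕ) : ∀ (p : List Bool) (k : ℕ) (x : ℝ) (s s' : ETState), WF s →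
    s.label p ≠ none → x ∈ Set.Ico (0:ℝ) 1 →
    etInsert d p (dy k x) x s = (true, s') → ∃ q b m, q.length + 1 + m = d ∧
      s.label (p ++ q) = some (dy (p ++ q).length x) ∧ s.label (p ++ q ++ [b]) = none ∧
      Chain m (p ++ q ++ [b]) x s s' ∧
      (b = true → s.label (p ++ q ++ [false]) ≠ none) ∧
      ∀ a c, (a ++ [true]) <+: (q ++ [b]) → a.length + 1 + c.length < d →
        s.label (p ++ (a ++ false :: c)) = some (dy (p ++ (a ++ false :: c)).length x) →
        ∀ e, s.label (p ++ (a ++ false :: c) ++ [e]) ≠ none := by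
  induction d with
  | zero =>
    intro p k x s s' hs hp hx h
    simp only [etInsert] at h
    cases hl : s.label p with
    | none => exact absurd hl hp
    | some I => simp [hl] at h
  | succ d ih =>
    intro p k x s s' hs hp hx h
    cases hl : s.label p with
    | none => exact absurd hl hp
    | some I =>
      obtain ⟨y, hy, rfl⟩ := hs.exists_y hl
      simp only [etInsert, hl, mem_dy] at h
      split_ifs at h with hI
      · rw [← hI] at h hl
        rcases hE : etInsert d (p ++ [false]) (dy p.length x) x s with ⟨b1, s1⟩
        rw [hE] at h
        cases b1 with
        | true =>
          simp only [Prod.mk.injEq, true_and] at h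
          subst h
          by_cases hL : s.label (p ++ [false]) = none
          · have hU := (insert_unmarked d (p ++ [false]) p.length x s (by simp) (by
              intro c; by_contra hc; exact hs.marked _ _ hc hL)).2
            rw [hE] at hU
            refine ⟨[], false, d, by simp; omega, by simpa using hl, by simpa using hL,
              by simpa using hU, by simp, ?_⟩
            intro a c ha
            exfalso
            have h1 := ha.length_le
            simp at h1; subst h1; simp at ha
          · obtain ⟨q, b, m, h1, h2, h3, h4, h5, h6⟩ := ih _ _ _ _ _ hs hL hx hE
            refine ⟨false :: q, b, m, by simp; omega, by simpa using h2, by simpa using h3,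
              by simpa using h4, by simpa using h5, ?_⟩
            intro a c ha hlen hlab e
            cases a with
            | nil => simp at ha
            | cons a0 a =>
              simp only [List.cons_append, List.cons_prefix_cons] at ha
              obtain ⟨rfl, ha⟩ := ha
              have := h6 a c ha (by simp at hlen; omega) (by simpa using hlab) e
              simpa using this
        | false =>
          simp only at h
          obtain ⟨rfl, hm1, hf1⟩ := insert_fail _ _ _ _ _ _ hs (by simp) hx hE
          by_cases hR : s1.label (p ++ [true]) = none
          · have hU := (insert_unmarked d (p ++ [true]) p.length x s1 (by simp) (by
              intro c; by_contra hc; exact hs.marked _ _ hc hR)).2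
            rw [h] at hU
            refine ⟨[], true, d, by simp; omega, by simpa using hl, by simpa using hR,
              by simpa using hU, by simpa using hm1, ?_⟩
            intro a c ha hlen hlab e
            have h1 := ha.length_le
            simp at h1; subst h1
            have := hf1 c (by simp at hlen; omega) (by simpa using hlab) e
            simpa using this
          · obtain ⟨q, b, m, h1, h2, h3, h4, h5, h6⟩ := ih _ _ _ _ _ hs hR hx h
            refine ⟨true :: q, b, m, by simp; omega, by simpa using h2, by simpa using h3,
              by simpa using h4, by simpa using h5, ?_⟩
            intro a c ha hlen hlab e
            cases a with
            | nil =>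
              have := hf1 c (by simp at hlen; omega) (by simpa using hlab) e
              simpa using this
            | cons a0 a =>
              simp only [List.cons_append, List.cons_prefix_cons] at ha
              obtain ⟨rfl, ha⟩ := ha
              have := h6 a c ha (by simp at hlen; omega) (by simpa using hlab) e
              simpa using this
      · simp at h

structure Good (H : ℕ) (s : ETState) : Prop where
  wf : WF s
  lf : ∀ t, s.label (t ++ [true]) ≠ none → s.label (t ++ [false]) ≠ none
  ld : ∀ t, t ≠ [] → t.length < H → s.label t ≠ none → s.label (t ++ [false]) ≠ none
  occ1 : ∀ t, s.occ t ≠ none → s.label t ≠ none ∧ t ≠ []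
  occ2 : ∀ t, t ≠ [] → t.length = H → s.label t ≠ none → s.occ t ≠ none

def Before (j : ℕ) (u : List Bool) (j' : ℕ) (v : List Bool) : Prop :=
  j < j' ∨ (j = j' ∧ ∃ a c c', u = a ++ false :: c ∧ v = a ++ true :: c')

def FInv (H : ℕ) (f : ℕ → ETState) : Prop :=
  (∀ j, Good H (f j)) ∧
  ∀ j j' u v, u.length = v.length → u.length < H → Before j u j' v →
    (f j).label u ≠ none → (f j).label u = (f j').label v →
    (f j').label (v ++ [false]) ≠ none → ∀ b, (f j).label (u ++ [b]) ≠ none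

structure Step (H : ℕ) (s s' : ETState) (x : ℝ) (q : List Bool) (b : Bool) (m : ℕ) : Prop where
  len : q.length + 1 + m = H
  lab : s.label q = some (dy q.length x)
  emp : s.label (q ++ [b]) = none
  chain : Chain m (q ++ [b]) x s s'
  left : b = true → s.label (q ++ [false]) ≠ none
  full : ∀ a c, (a ++ [true]) <+: (q ++ [b]) → a.length + 1 + c.length < H →
        s.label (a ++ false :: c) = some (dy (a ++ false :: c).length x) →
        ∀ e, s.label (a ++ false :: c ++ [e]) ≠ none

theorem Step.new {H s s' x q b m} (h : Step H s s' x q b m) {t : List Bool} {i : ℕ} (hi : i ≤ m)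
    (ht : t = q ++ b :: List.replicate i false) : s'.label t = some (dy t.length x) := by
  rw [h.chain.1, if_pos ⟨i, hi, by simp [ht]⟩]

theorem Step.cases {H s s' x q b m} (h : Step H s s' x q b m) (t : List Bool) :
    (∃ i ≤ m, t = q ++ b :: List.replicate i false) ∨ s'.label t = s.label t := by
  by_cases hc : ∃ i ≤ m, t = q ++ b :: List.replicate i false
  · exact Or.inl hc
  · right
    rw [h.chain.1, if_neg]
    rintro ⟨i, hi, rfl⟩
    exact hc ⟨i, hi, by simp⟩

theorem Step.old_none {H s s' x q b m} (h : Step H s s' x q b m) (hs : WF s) (c : List Bool) :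
    s.label (q ++ b :: c) = none := by
  by_contra hc
  exact hs.marked (q ++ [b]) c (by simpa using hc) h.emp

theorem Step.mono {H s s' x q b m} (h : Step H s s' x q b m) (hs : WF s) {t : List Bool}
    (ht : s.label t ≠ none) : s'.label t = s.label t := by
  rcases h.cases t with ⟨i, hi, rfl⟩ | h1
  · exact absurd (h.old_none hs _) ht
  · exact h1

theorem Step.mono' {H s s' x q b m} (h : Step H s s' x q b m) (hs : WF s) {t : List Bool}
    (ht : s.label t ≠ none) : s'.label t ≠ none := by
  rwa [h.mono hs ht]

theorem snoc_chain {t q : List Bool} {e b : Bool} {i : ℕ}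
    (h : t ++ [e] = q ++ b :: List.replicate i false) :
    (t = q ∧ e = b ∧ i = 0) ∨ ∃ i', i = i' + 1 ∧ e = false ∧
      t = q ++ b :: List.replicate i' false := by
  cases i with
  | zero =>
    left
    have := List.append_inj' h (by simp)
    simpa using this
  | succ i =>
    right
    refine ⟨i, rfl, ?_⟩
    rw [List.replicate_succ'] at h
    have h' : t ++ [e] = (q ++ b :: List.replicate i false) ++ [false] := by simpa using h
    have := List.append_inj' h' (by simp)
    simpa [and_comm] using this

theorem Step.good {H s s' x q b m} (h : Step H s s' x q b m) (hs : Good H s)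
    (hx : x ∈ Set.Ico (0:ℝ) 1) : Good H s' := by
  have hwf := hs.wf
  have hq : s'.label q = some (dy q.length x) := by
    rw [h.mono hwf (by simp [h.lab]), h.lab]
  have hocc : ∀ t, s.occ t ≠ none → s'.occ t ≠ none := by
    intro t ht
    rw [h.chain.2]
    split_ifs <;> simp [ht]
  refine ⟨⟨?_, ?_⟩, ?_, ?_, ?_, ?_⟩
  · rw [h.mono hwf (by simp [hwf.1]), hwf.1]
  · intro t e J hJ
    rcases h.cases (t ++ [e]) with ⟨i, hi, ht⟩ | h1
    · have h2 := h.new hi ht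
      rw [hJ] at h2
      refine ⟨x, hx, by simpa using h2, ?_⟩
      rcases snoc_chain ht with ⟨rfl, -, -⟩ | ⟨i', rfl, -, ht'⟩
      · exact hq
      · exact h.new (by omega) ht'
    · rw [h1] at hJ
      obtain ⟨y, hy, h2, h3⟩ := hwf.2 _ _ _ hJ
      exact ⟨y, hy, h2, by rw [h.mono hwf (by simp [h3]), h3]⟩
  · intro t ht
    rcases h.cases (t ++ [true]) with ⟨i, hi, ht'⟩ | h1
    · rcases snoc_chain ht' with ⟨rfl, hb, -⟩ | ⟨i', rfl, hb, -⟩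
      · exact h.mono' hwf (h.left hb.symm)
      · simp at hb
    · rw [h1] at ht
      exact h.mono' hwf (hs.lf _ ht)
  · intro t ht hlen hlab
    rcases h.cases t with ⟨i, hi, rfl⟩ | h1
    · have hl := h.len
      simp at hlen
      rw [h.new (i := i + 1) (by omega) (by simp [List.replicate_succ'])]
      simp
    · rw [h1] at hlab
      exact h.mono' hwf (hs.ld _ ht hlen hlab)
  · intro t ht
    rw [h.chain.2] at ht
    split_ifs at ht with h1
    · refine ⟨?_, by simp [h1]⟩
      rw [h.new (i := m) le_rfl (by simpa using h1)]; simp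
    · obtain ⟨h2, h3⟩ := hs.occ1 t ht
      exact ⟨h.mono' hwf h2, h3⟩
  · intro t ht hlen hlab
    rcases h.cases t with ⟨i, hi, rfl⟩ | h1
    · have hl := h.len
      simp at hlen
      have : i = m := by omega
      subst this
      rw [h.chain.2, if_pos (by simp)]; simp
    · rw [h1] at hlab
      exact hocc _ (hs.occ2 t ht hlen hlab)

theorem before_irrefl {j : ℕ} {u : List Bool} (h : Before j u j u) : False := by
  rcases h with h | ⟨-, a, c, c', h1, h2⟩
  · omega
  · rw [h1] at h2
    simp at h2

theorem FInv.step {H : ℕ} {f : ℕ → ETState} (hf : FInv H f) {x : ℝ} (hx : x ∈ Set.Ico (0:ℝ) 1)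
    {j0 : ℕ} {s' : ETState} {q b m} (h : Step H (f j0) s' x q b m)
    (hfail : ∀ j < j0, ∀ c : List Bool, c.length < H → (f j).label c = some (dy c.length x) →
      ∀ e, (f j).label (c ++ [e]) ≠ none) :
    FInv H (fun i => if i = j0 then s' else f i) := by
  obtain ⟨hg, hi⟩ := hf
  set g : ℕ → ETState := fun i => if i = j0 then s' else f i with hgdef
  have g0 : g j0 = s' := by simp [hgdef]
  have gn : ∀ j, j ≠ j0 → g j = f j := by intro j hj; simp [hgdef, hj]
  have mono : ∀ j t, (f j).label t ≠ none → (g j).label t = (f j).label t := by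
    intro j t ht
    by_cases hj : j = j0
    · subst hj; rw [g0, h.mono (hg _).wf ht]
    · rw [gn j hj]
  have mono' : ∀ j t, (f j).label t ≠ none → (g j).label t ≠ none := by
    intro j t ht; rwa [mono j t ht]
  have gcases : ∀ j t, (j = j0 ∧ ∃ i ≤ m, t = q ++ b :: List.replicate i false) ∨
      (g j).label t = (f j).label t := by
    intro j t
    by_cases hj : j = j0
    · subst hj
      rw [g0]
      rcases h.cases t with h1 | h1
      · exact Or.inl ⟨rfl, h1⟩
      · exact Or.inr h1
    · rw [gn j hj]; exact Or.inr rfl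
  have gG : ∀ j, Good H (g j) := by
    intro j
    by_cases hj : j = j0
    · subst hj; rw [g0]; exact h.good (hg _) hx
    · rw [gn j hj]; exact hg j
  refine ⟨gG, ?_⟩
  intro j j' u v hlen hH hB hu huv hv e
  rcases gcases j' (v ++ [false]) with ⟨rfl, i, him, hvc⟩ | hold
  · -- newly marked
    have hvlab : (g j').label v = some (dy v.length x) := by
      rcases snoc_chain hvc with ⟨rfl, -, -⟩ | ⟨i', rfl, -, ht'⟩
      · rw [mono _ _ (by simp [h.lab]), h.lab]
      · rw [g0]; exact h.new (by omega) ht'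
    have hulab : (g j).label u = some (dy u.length x) := by rw [huv, hvlab, hlen]
    have hlt : ∀ i', v = q ++ b :: List.replicate i' false ∨ v = q →
        ∀ a c', v = a ++ true :: c' → (a ++ [true]) <+: (q ++ [b]) := by
      intro i' hv' a c' hva
      rcases hv' with hv' | hv'
      · have e1 : (a ++ [true]) <+: ((q ++ [b]) ++ List.replicate i' false) := by
          refine ⟨c', ?_⟩
          simp [← hva, hv']
        rcases List.prefix_or_prefix_of_prefix e1 (List.prefix_append (q ++ [b]) _) with h1 | h1
        · exact h1
        · obtain ⟨r, hr⟩ := h1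
          rcases List.eq_nil_or_concat r with rfl | ⟨r, d, rfl⟩
          · simp only [List.append_nil] at hr; rw [hr]
          · exfalso
            rw [← hr, List.prefix_append_right_inj] at e1
            obtain ⟨z, hz⟩ := e1
            have hd : d = true := by
              have := List.append_inj' (s₁ := q ++ [b] ++ r) (t₁ := [d]) (s₂ := a) (t₂ := [true])
                (by simpa using hr) rfl
              simpa using this.2
            have : true ∈ List.replicate i' false := by
              rw [← hz, hd]; simp
            simp at this
      · refine ⟨c' ++ [b], ?_⟩
        simp [← hv', hva]
    have hchain : ∃ i', v = q ++ b :: List.replicate i' false ∨ v = q := by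
      rcases snoc_chain hvc with ⟨h1, -, -⟩ | ⟨i', rfl, -, ht'⟩
      · exact ⟨0, Or.inr h1⟩
      · exact ⟨i', Or.inl ht'⟩
    obtain ⟨i', hi'⟩ := hchain
    rcases gcases j u with ⟨rfl, k, hk, huc⟩ | hold
    · exfalso
      have : u = v := by
        rcases hi' with hv' | hv'
        · have : k = i' := by
            rw [huc, hv'] at hlen; simpa using hlen
          rw [huc, hv', this]
        · rw [huc, hv'] at hlen; simp at hlen
      subst this
      exact before_irrefl hB
    · rw [hold] at hulab
      apply mono'
      rcases hB with hB | ⟨rfl, a, c, c', rfl, hva⟩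
      · exact hfail j hB u hH hulab e
      · exact h.full a c (hlt i' hi' a c' hva) (by simp at hH; omega) hulab e
  · rw [hold] at hv
    have hvm : (f j').label v ≠ none := (hg j').wf.marked _ _ hv
    have hvg := mono _ _ hvm
    rcases gcases j u with ⟨rfl, k, hk, huc⟩ | holdu
    · exfalso
      have hulab : (g j).label u = some (dy u.length x) := by rw [g0]; exact h.new hk huc
      have hvlab : (f j').label v = some (dy v.length x) := by
        rw [← hvg, ← huv, hulab, hlen]
      have hql : q.length < v.length := by rw [← hlen, huc]; simp
      -- ancestor of v
      have key : ∀ r w, v = r ++ w → r.length = q.length → Before j q j' r → False := by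
        intro r w hvr hrl hBr
        have hrlab : (f j').label r = some (dy r.length x) := by
          apply (hg j').wf.nest r w; rw [← hvr]; exact hvlab
        have hwne : w ≠ [] := by rintro rfl; simp at hvr; subst hvr; omega
        obtain ⟨d, w', rfl⟩ := List.exists_cons_of_ne_nil hwne
        have hrd : (f j').label (r ++ [d]) ≠ none := by
          apply (hg j').wf.marked (r ++ [d]) w'
          have : r ++ [d] ++ w' = v := by simp [hvr]
          rw [this]; exact hvm
        have hrf : (f j').label (r ++ [false]) ≠ none := by
          cases d
          · exact hrd
          · exact (hg j').lf _ hrd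
        exact hi j j' q r hrl.symm (by have := h.len; omega) hBr (by simp [h.lab])
          (by rw [h.lab, hrlab, hrl]) hrf b h.emp
      rcases hB with hB | ⟨rfl, a, c, c', hua, hva⟩
      · exact key (v.take q.length) (v.drop q.length) (by simp) (by simp; omega) (Or.inl hB)
      · have hqa : q ++ b :: List.replicate k false = a ++ false :: c := by rw [← huc, hua]
        rcases List.append_eq_append_iff.1 hqa with ⟨a', ha1, ha2⟩ | ⟨a', ha1, ha2⟩
        · -- a = q ++ a'
          cases a' with
          | nil =>
            simp at ha1 ha2
            obtain ⟨rfl, -⟩ := ha2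
            subst ha1
            have h1 : (f j).label (a ++ [true]) ≠ none := by
              apply (hg j).wf.marked _ c'
              have : a ++ [true] ++ c' = v := by simp [hva]
              rw [this]; exact hvm
            exact (hg j).lf _ h1 h.emp
          | cons d a' =>
            simp at ha2
            obtain ⟨rfl, -⟩ := ha2
            apply hvm
            rw [hva, ha1]
            simpa using h.old_none (hg j).wf (a' ++ true :: c')
        · -- q = a ++ a'
          cases a' with
          | nil =>
            simp at ha1 ha2
            obtain ⟨rfl, -⟩ := ha2
            subst ha1
            have h1 : (f j).label (q ++ [true]) ≠ none := by
              apply (hg j).wf.marked _ c'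
              have : q ++ [true] ++ c' = v := by simp [hva]
              rw [this]; exact hvm
            exact (hg j).lf _ h1 h.emp
          | cons d a' =>
            simp at ha2
            obtain ⟨rfl, -⟩ := ha2
            refine key (a ++ true :: c'.take a'.length) (c'.drop a'.length) (by simp [hva]) ?_ ?_
            · rw [hva, ha1] at hql
              simp at hql
              rw [ha1]
              simp; omega
            · exact Or.inr ⟨rfl, a, a', _, ha1, rfl⟩
    · rw [holdu] at hu
      rw [holdu, hvg] at huv
      exact mono' _ _ (hi j j' u v hlen hH hB hu huv hv e)

theorem Good.init (H : ℕ) : Good H (ETState.init (0, 1)) := by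
  refine ⟨⟨by simp [ETState.init], ?_⟩, ?_, ?_, ?_, ?_⟩ <;> simp [ETState.init]
  all_goals (intro t h1; intros; assumption)

theorem FInv.init (H : ℕ) : FInv H (fun _ => ETState.init (0, 1)) := by
  refine ⟨fun _ => Good.init H, ?_⟩
  intro j j' u v _ _ _ _ _ h
  simp [ETState.init] at h

theorem multiInsert_cases {H : ℕ} {f : ℕ → ETState} (hf : FInv H f) {x : ℝ}
    (hx : x ∈ Set.Ico (0:ℝ) 1) :
    multiInsert H x f = f ∨ ∃ j0 s' q b m, Step H (f j0) s' x q b m ∧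
      FInv H (fun i => if i = j0 then s' else f i) ∧
      multiInsert H x f = (fun i => if i = j0 then s' else f i) := by
  unfold multiInsert
  split_ifs with hex
  · right
    have htop : ∀ j, etInsertTop H x (f j) = etInsert H [] (dy 0 x) x (f j) := by
      intro j
      rw [etInsertTop, (hf.1 j).wf.1, dy_zero hx]; rfl
    have h1 := Nat.find_spec hex
    have h2 : ∀ j < Nat.find hex, _ := fun j hj => Nat.find_min hex hj
    set j0 := Nat.find hex
    rw [htop] at h1
    rcases hE : etInsert H [] (dy 0 x) x (f j0) with ⟨b1, s'⟩
    rw [hE] at h1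
    simp only at h1
    subst h1
    obtain ⟨q, b, m, a1, a2, a3, a4, a5, a6⟩ := insert_succ H [] 0 x (f j0) s' (hf.1 _).wf
      (by simp [(hf.1 j0).wf.1]) hx hE
    have hS : Step H (f j0) s' x q b m := ⟨a1, a2, a3, a4, a5, a6⟩
    refine ⟨j0, s', q, b, m, hS, hf.step hx hS ?_, ?_⟩
    · intro j hj c hc hlab e
      have h3 := h2 j hj
      rw [htop] at h3
      rcases hE' : etInsert H [] (dy 0 x) x (f j) with ⟨b2, s2⟩
      rw [hE'] at h3
      simp at h3
      subst h3
      exact (insert_fail H [] 0 x (f j) s2 (hf.1 _).wf (by simp) hx hE').2.2 c hc hlab e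
    · rw [htop, hE]
  · left; rfl

theorem sec3Run_snoc (H : ℕ) (l : List ℝ) (x : ℝ) :
    sec3Run H (l ++ [x]) = multiInsert H x (sec3Run H l) := by
  simp [sec3Run]

theorem sec3Run_inv (H : ℕ) (l : List ℝ) (hl : ∀ x ∈ l, x ∈ Set.Ico (0 : ℝ) 1) :
    FInv H (sec3Run H l) := by
  induction l using List.reverseRecOn with
  | nil => exact FInv.init H
  | append_singleton l x ih =>
    have ih := ih (fun y hy => hl y (by simp [hy]))
    rw [sec3Run_snoc]
    rcases multiInsert_cases ih (hl x (by simp)) with h | ⟨j0, s', q, b, m, -, h1, h2⟩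
    · rw [h]; exact ih
    · rw [h2]; exact h1

theorem pathOfIdx_length (H i : ℕ) : (pathOfIdx H i).length = H := by simp [pathOfIdx]

theorem pathOfIdx_inj {H : ℕ} {i i' : Fin (2 ^ H)} (h : pathOfIdx H i.1 = pathOfIdx H i'.1) :
    i = i' := by
  apply Fin.ext
  apply Nat.eq_of_testBit_eq
  intro k
  by_cases hk : k < H
  · simp only [pathOfIdx, List.map_inj_left, List.mem_range] at h
    have := h (H - 1 - k) (by omega)
    have e : H - 1 - (H - 1 - k) = k := by omega
    rwa [e] at this
  · have hle : 2 ^ H ≤ 2 ^ k := Nat.pow_le_pow_right (by norm_num) (by omega)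
    rw [Nat.testBit_lt_two_pow (lt_of_lt_of_le i.2 hle),
      Nat.testBit_lt_two_pow (lt_of_lt_of_le i'.2 hle)]

theorem exists_frontier (s : ETState) (c : List Bool) : ∀ p, s.label p ≠ none →
    s.label (p ++ c) = none → ∃ c1 b c2, c = c1 ++ b :: c2 ∧ s.label (p ++ c1) ≠ none ∧
      s.label (p ++ c1 ++ [b]) = none := by
  induction c with
  | nil => intro p h1 h2; simp at h2; exact absurd h2 h1
  | cons e c ih =>
    intro p h1 h2
    by_cases he : s.label (p ++ [e]) = none
    · exact ⟨[], e, c, by simp, by simpa using h1, by simpa using he⟩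
    · obtain ⟨c1, b, c2, h3, h4, h5⟩ := ih (p ++ [e]) he (by simpa using h2)
      exact ⟨e :: c1, b, c2, by simp [h3], by simpa using h4, by simpa using h5⟩

theorem list_tri (u : List Bool) : ∀ v : List Bool, u.length = v.length → u ≠ v →
    (∃ a c c', u = a ++ false :: c ∧ v = a ++ true :: c') ∨
    (∃ a c c', v = a ++ false :: c ∧ u = a ++ true :: c') := by
  induction u with
  | nil => intro v h1 h2; cases v <;> simp_all
  | cons e u ih =>
    intro v h1 h2
    cases v with
    | nil => simp at h1
    | cons e' v =>
      by_cases he : e = e'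
      · subst he
        rcases ih v (by simpa using h1) (by simpa using h2) with ⟨a, c, c', h3, h4⟩ | ⟨a, c, c', h3, h4⟩
        · exact Or.inl ⟨e :: a, c, c', by simp [h3], by simp [h4]⟩
        · exact Or.inr ⟨e :: a, c, c', by simp [h3], by simp [h4]⟩
      · cases e <;> cases e' <;> simp at he
        · exact Or.inl ⟨[], u, v, rfl, rfl⟩
        · exact Or.inr ⟨[], v, u, rfl, rfl⟩

def emptyS (H M : ℕ) (f : ℕ → ETState) : Finset (ℕ × Fin (2 ^ H)) :=
  (Finset.range M ×ˢ Finset.univ).filter fun z =>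
    treeNonempty H (f z.1) ∧ (f z.1).occ (pathOfIdx H z.2.1) = none

def occS (H M : ℕ) (f : ℕ → ETState) : Finset (ℕ × Fin (2 ^ H)) :=
  (Finset.range M ×ˢ Finset.univ).filter fun z => (f z.1).occ (pathOfIdx H z.2.1) ≠ none

theorem emptyS_card (H M : ℕ) (f : ℕ → ETState) :
    (emptyS H M f).card =
      ∑ k ∈ Finset.range M, if treeNonempty H (f k) then emptyCellCount H (f k) else 0 := by
  rw [emptyS, Finset.card_filter, Finset.sum_product]
  apply Finset.sum_congr rfl
  intro k _
  split_ifs with h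
  · simp [h, emptyCellCount]
  · simp [h]

theorem occS_card (H M : ℕ) (f : ℕ → ETState) :
    (occS H M f).card = ∑ k ∈ Finset.range M,
      (Finset.univ.filter fun i : Fin (2 ^ H) => (f k).occ (pathOfIdx H i.1) ≠ none).card := by
  rw [occS, Finset.card_filter, Finset.sum_product]
  apply Finset.sum_congr rfl
  intro k _
  rw [Finset.card_filter]

theorem emptyS_le (H M : ℕ) (f : ℕ → ETState) (hf : FInv H f) :
    (emptyS H M f).card ≤ H * 2 ^ (H - 1) := by
  let T := Σ k : Fin H, Fin (2 ^ k.1) × List.Vector Bool (H - 1 - k.1)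
  let P : ℕ × Fin (2 ^ H) → T → Prop := fun z τ => ∃ w y, y ∈ Set.Ico (0:ℝ) 1 ∧
    pathOfIdx H z.2.1 = w ++ true :: τ.2.2.toList ∧ w.length = τ.1.1 ∧
    ⌊(2:ℝ)^τ.1.1 * y⌋ = (τ.2.1.1 : ℤ) ∧ (f z.1).label w = some (dy w.length y) ∧
    (f z.1).label (w ++ [false]) ≠ none ∧ (f z.1).label (w ++ [true]) = none
  have hex : ∀ z ∈ emptyS H M f, ∃ τ, P z τ := by
    rintro ⟨j, i⟩ hz
    simp only [emptyS, Finset.mem_filter] at hz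
    obtain ⟨-, ⟨i0, hne⟩, hocc⟩ := hz
    have g := hf.1 j
    obtain ⟨hm0, hn0⟩ := g.occ1 _ hne
    have hlen0 := pathOfIdx_length H i0.1
    have hlen := pathOfIdx_length H i.1
    set t0 := pathOfIdx H i0.1
    set t := pathOfIdx H i.1 with htdef
    have hHpos : 0 < H := by rw [← hlen0]; exact List.length_pos_iff.2 hn0
    have htn : t ≠ [] := by rw [← List.length_pos_iff]; omega
    have hlab : (f j).label t = none := by
      by_contra hc; exact g.occ2 t htn hlen hc hocc
    obtain ⟨w, b, c, h1, h2, h3⟩ := exists_frontier (f j) t [] (by simp [g.wf.1]) (by simpa using hlab)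
    simp only [List.nil_append] at h2 h3
    have hwl : w.length + 1 + c.length = H := by rw [← hlen, h1]; simp; omega
    have hleft : (f j).label (w ++ [false]) ≠ none := by
      by_cases hw : w = []
      · subst hw
        obtain ⟨d, t', ht'⟩ := List.exists_cons_of_ne_nil hn0
        have hd : (f j).label ([] ++ [d]) ≠ none := by
          apply g.wf.marked _ t'
          simpa [← ht'] using hm0
        cases d
        · exact hd
        · exact g.lf _ hd
      · exact g.ld w hw (by omega) h2
    have hb : b = true := by
      cases b
      · exact absurd h3 hleft
      · rfl
    subst hb
    obtain ⟨J, hJ⟩ := Option.ne_none_iff_exists'.1 h2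
    obtain ⟨y, hy, rfl⟩ := g.wf.exists_y hJ
    have hp : (0:ℝ) < 2 ^ w.length := by positivity
    have f0 : 0 ≤ ⌊(2:ℝ)^w.length * y⌋ := by
      apply Int.floor_nonneg.2; have := hy.1; positivity
    have f1 : ⌊(2:ℝ)^w.length * y⌋ < 2 ^ w.length := by
      rw [Int.floor_lt]; push_cast
      have := hy.2; nlinarith
    refine ⟨⟨⟨w.length, by omega⟩, ⟨⌊(2:ℝ)^w.length * y⌋.toNat, ?_⟩, ⟨c, ?_⟩⟩, w, y, hy, h1, rfl, ?_,
      hJ, hleft, h3⟩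
    · zify; rw [Int.toNat_of_nonneg f0]; exact f1
    · simp only; omega
    · simp only; rw [Int.toNat_of_nonneg f0]
  have key : ∀ j w j' w', w.length = w'.length → w.length < H → Before j w j' w' →
      (f j).label w ≠ none → (f j).label w = (f j').label w' →
      (f j').label (w' ++ [false]) ≠ none → (f j).label (w ++ [true]) = none → False := by
    intro j w j' w' h1 h2 h3 h4 h5 h6 h7
    exact hf.2 j j' w w' h1 h2 h3 h4 h5 h6 true h7
  have hinj : ∀ z z' τ, P z τ → P z' τ → z = z' := by
    rintro ⟨j, i⟩ ⟨j', i'⟩ τ ⟨w, y, hy, h1, h2, h3, h4, h5, h6⟩ ⟨w', y', hy', h1', h2', h3', h4', h5', h6'⟩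
    simp only at *
    have hww : w.length = w'.length := by omega
    have hwH : w.length < H := by rw [h2]; exact τ.1.2
    have hlab : (f j).label w = (f j').label w' := by
      rw [h4, h4', hww]
      congr 1
      apply dy_floor
      rw [h2', h3, h3']
    rcases lt_trichotomy j j' with hj | hj | hj
    · exact (key j w j' w' hww hwH (Or.inl hj) (by simp [h4]) hlab h5' h6).elim
    · subst hj
      by_cases hw : w = w'
      · subst hw
        rw [← h1'] at h1
        rw [pathOfIdx_inj h1]
      · rcases list_tri w w' hww hw with h | h
        · exact (key j w j w' hww hwH (Or.inr ⟨rfl, h⟩) (by simp [h4]) hlab h5' h6).elim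
        · exact (key j w' j w hww.symm (by omega) (Or.inr ⟨rfl, h⟩) (by simp [h4']) hlab.symm h5 h6').elim
    · exact (key j' w' j w hww.symm (by omega) (Or.inl hj) (by simp [h4']) hlab.symm h5 h6').elim
  have hT : Fintype.card T = H * 2 ^ (H - 1) := by
    simp only [T, Fintype.card_sigma, Fintype.card_prod, Fintype.card_fin, card_vector,
      Fintype.card_bool]
    rw [Finset.sum_congr rfl (g := fun _ => 2 ^ (H - 1))]
    · simp
    · intro k _
      rw [← pow_add]
      congr 1
      have := k.2
      omega
  rw [← hT, ← Fintype.card_coe]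
  choose g hg using hex
  apply Fintype.card_le_of_injective (fun z : emptyS H M f => g z.1 z.2)
  intro z z' h
  apply Subtype.ext
  apply hinj _ _ (g z.1 z.2) (hg _ _)
  simp only at h
  rw [h]
  exact hg _ _

theorem occS_le (H M : ℕ) (l : List ℝ) (hl : ∀ x ∈ l, x ∈ Set.Ico (0 : ℝ) 1) :
    (occS H M (sec3Run H l)).card ≤ l.length := by
  induction l using List.reverseRecOn with
  | nil => simp [occS, sec3Run, ETState.init]
  | append_singleton l x ih =>
    have hl' : ∀ y ∈ l, y ∈ Set.Ico (0 : ℝ) 1 := fun y hy => hl y (by simp [hy])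
    have ih := ih hl'
    rw [sec3Run_snoc]
    rcases multiInsert_cases (sec3Run_inv H l hl') (hl x (by simp)) with h | ⟨j0, s', q, b, m, hS, -, h2⟩
    · rw [h]; simp; omega
    · rw [h2]
      set f := sec3Run H l
      let Q : Finset (ℕ × Fin (2 ^ H)) := (Finset.range M ×ˢ Finset.univ).filter fun z =>
        z.1 = j0 ∧ pathOfIdx H z.2.1 = q ++ [b] ++ List.replicate m false
      have hQ : Q.card ≤ 1 := by
        rw [Finset.card_le_one]
        rintro ⟨j, i⟩ hz ⟨j', i'⟩ hz'
        simp only [Q, Finset.mem_filter] at hz hz'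
        have h3 := pathOfIdx_inj (hz.2.2.trans hz'.2.2.symm)
        rw [h3, hz.2.1, hz'.2.1]
      have hsub : occS H M (fun i => if i = j0 then s' else f i) ⊆ occS H M f ∪ Q := by
        rintro ⟨j, i⟩ hz
        simp only [occS, Q, Finset.mem_union, Finset.mem_filter] at hz ⊢
        obtain ⟨hz1, hz2⟩ := hz
        by_cases hj : j = j0
        · subst hj
          simp only [if_true] at hz2
          rw [hS.chain.2] at hz2
          split_ifs at hz2 with hc
          · exact Or.inr ⟨hz1, rfl, hc⟩
          · exact Or.inl ⟨hz1, hz2⟩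
        · simp only [hj, if_false] at hz2
          exact Or.inl ⟨hz1, hz2⟩
      have := (Finset.card_le_card hsub).trans (Finset.card_union_le _ _)
      simp
      omega

theorem H_bound (n : ℕ) (hn : 2 ≤ n) (ε : ℝ)
    (hε₁ : Real.logb 2 n / n ≤ ε) (hε₂ : ε ≤ 1)
    (H : ℕ) (hH : H = ⌊Real.logb 2 (ε * n) - Real.logb 2 (Real.logb 2 n)⌋₊) :
    ((H * 2 ^ (H - 1) : ℕ) : ℝ) ≤ ε * n := by
  have hn' : (2:ℝ) ≤ n := by exact_mod_cast hn
  have hnp : (0:ℝ) < n := by linarith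
  set L := Real.logb 2 n with hL
  have hL1 : 1 ≤ L := by
    rw [hL, Real.le_logb_iff_rpow_le (by norm_num) hnp]; simpa using hn'
  have hLe : L ≤ ε * n := by rwa [div_le_iff₀ hnp] at hε₁
  have hep : 0 < ε * n := by linarith
  have hdiff : 0 ≤ Real.logb 2 (ε * n) - Real.logb 2 L :=
    sub_nonneg.2 (Real.logb_le_logb_of_le (by norm_num) (by linarith) hLe)
  have hHle : (H:ℝ) ≤ Real.logb 2 (ε * n) - Real.logb 2 L := by
    rw [hH]; exact Nat.floor_le hdiff
  have hLL : 0 ≤ Real.logb 2 L := Real.logb_nonneg (by norm_num) hL1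
  have hle2 : Real.logb 2 (ε * n) ≤ L :=
    Real.logb_le_logb_of_le (by norm_num) hep (by nlinarith)
  have hHL : (H:ℝ) ≤ L := by linarith
  have h2H : (2:ℝ) ^ H ≤ ε * n / L := by
    rw [← Real.logb_div hep.ne' (by linarith), Real.le_logb_iff_rpow_le (by norm_num)
      (by positivity), Real.rpow_natCast] at hHle
    exact hHle
  rw [le_div_iff₀ (by linarith)] at h2H
  push_cast
  have h3 : (2:ℝ) ^ (H - 1) ≤ 2 ^ H := pow_le_pow_right₀ (by norm_num) (by omega)
  have h4 : (0:ℝ) < 2 ^ (H - 1) := by positivity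
  calc (H:ℝ) * 2 ^ (H - 1) ≤ L * 2 ^ H := by gcongr
    _ ≤ ε * n := by linarith

/-!
STATEMENT 13: in the Section-3 algorithm with `log₂ n / n ≤ ε ≤ 1` applied to a sequence
of at most `n` elements of `[0,1)`, at every point in time (i.e. after every prefix of the
input) the total number of empty array cells across the elementary trees containing at
least one element is at most `ε n`; consequently, after all `n` elements have been
inserted, the total number of array cells in the non-empty trees is at most `(1+ε) n`.
-/
theorem statement13 (n : ℕ) (hn : 2 ≤ n) (ε : ℝ)
    (hε₁ : Real.logb 2 n / n ≤ ε) (hε₂ : ε ≤ 1)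
    (H : ℕ) (hH : H = ⌊Real.logb 2 (ε * n) - Real.logb 2 (Real.logb 2 n)⌋₊)
    (xs : List ℝ) (hlen : xs.length ≤ n) (hxs : ∀ x ∈ xs, x ∈ Set.Ico (0 : ℝ) 1) :
    (∀ pre : List ℝ, pre <+: xs → ∀ M : ℕ,
      (∑ k ∈ Finset.range M,
        if treeNonempty H (sec3Run H pre k) then (emptyCellCount H (sec3Run H pre k) : ℝ)
        else 0) ≤ ε * n) ∧
    (xs.length = n → ∀ M : ℕ,
      (∑ k ∈ Finset.range M,
        if treeNonempty H (sec3Run H xs k) then ((2 ^ H : ℕ) : ℝ) else 0) ≤ (1 + ε) * n) := by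
  have key : ∀ pre : List ℝ, pre <+: xs → ∀ M : ℕ,
      (∑ k ∈ Finset.range M,
        if treeNonempty H (sec3Run H pre k) then (emptyCellCount H (sec3Run H pre k) : ℝ)
        else 0) ≤ ε * n := by
    intro pre hpre M
    have h1 := emptyS_le H M (sec3Run H pre)
      (sec3Run_inv H pre (fun x hx => hxs x (hpre.subset hx)))
    rw [emptyS_card] at h1
    have h2 : ((∑ k ∈ Finset.range M, if treeNonempty H (sec3Run H pre k) then
        emptyCellCount H (sec3Run H pre k) else 0 : ℕ) : ℝ) ≤ ((H * 2 ^ (H - 1) : ℕ) : ℝ) :=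
      Nat.cast_le.2 h1
    have h3 := h2.trans (H_bound n hn ε hε₁ hε₂ H hH)
    push_cast at h3
    exact h3
  refine ⟨key, ?_⟩
  intro hxn M
  have h1 := key xs (List.prefix_refl _) M
  have h2 := occS_le H M xs hxs
  rw [occS_card, hxn] at h2
  have h3 : ((∑ k ∈ Finset.range M, (Finset.univ.filter fun i : Fin (2 ^ H) =>
      (sec3Run H xs k).occ (pathOfIdx H i.1) ≠ none).card : ℕ) : ℝ) ≤ n := Nat.cast_le.2 h2
  rw [Nat.cast_sum] at h3
  have h4 : (∑ k ∈ Finset.range M,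
        if treeNonempty H (sec3Run H xs k) then ((2 ^ H : ℕ) : ℝ) else 0) ≤
      (∑ k ∈ Finset.range M,
        if treeNonempty H (sec3Run H xs k) then (emptyCellCount H (sec3Run H xs k) : ℝ)
        else 0) + ∑ k ∈ Finset.range M, ((Finset.univ.filter fun i : Fin (2 ^ H) =>
      (sec3Run H xs k).occ (pathOfIdx H i.1) ≠ none).card : ℝ) := by
    rw [← Finset.sum_add_distrib]
    apply Finset.sum_le_sum
    intro k _
    split_ifs with h
    · rw [emptyCellCount, ← Nat.cast_add, Finset.card_filter_add_card_filter_not]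
      simp
    · positivity
  linarith
end
end

section
/- Consider a sequence of elements inserted into a single composite tree A. If the elementary tree representing a node v of A at height h ≥ 2 with interval label I is non-empty (contains at least one element), then at least 2^{h−1} + 1 of the elements inserted into A so far lie in I. -/
noncomputable section
attribute [local instance] Classical.propDecidable

/-- The static label of the composite-tree node at path `p` when the root is labeled `I`:
each step descends to the left or right half of the parent's interval. -/
def staticLabel : (ℝ × ℝ) → List Bool → ℝ × ℝ
  | I, [] => I
  | I, b :: p =>
      staticLabel (if b then ((I.1 + I.2) / 2, I.2) else (I.1, (I.1 + I.2) / 2)) p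

/-- The state of a composite tree: each node (a path of length `≤ H - 1` from the root)
carries an elementary tree. -/
def CTState : Type := List Bool → ETState

/-- The initial state of a composite tree with root label `I`: every node carries an empty
elementary tree whose root is statically labeled with the node's static label. -/
def ctInit (I : ℝ × ℝ) : CTState := fun p => ETState.init (staticLabel I p)

/-- The path of length `d` descending from an interval `I` always into the half
containing `x`; this is the path to the unique depth-`d` node whose static label
contains `x`. -/
def descend (x : ℝ) : (ℝ × ℝ) → ℕ → List Bool
  | _, 0 => []
  | I, d + 1 =>
      if x < (I.1 + I.2) / 2 then false :: descend x (I.1, (I.1 + I.2) / 2) d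
      else true :: descend x ((I.1 + I.2) / 2, I.2) d

/-- The sequence of composite-tree nodes tried when inserting `x` into a composite tree of
height `H` with root label `I`: the unique admissible leaf (height 1), then its parent
(height 2), and so on up to the root (height `H`); each entry is the node's path paired
with the height of its elementary tree. -/
def ctNodeSeq (H : ℕ) (I : ℝ × ℝ) (x : ℝ) : List (List Bool × ℕ) :=
  (List.range H).map fun i => ((descend x I (H - 1)).take (H - 1 - i), i + 1)

/-- Try to insert `x` into the elementary trees at the listed composite-tree nodes, in
order, stopping at the first success. -/
def tryNodes (x : ℝ) : List (List Bool × ℕ) → CTState → Bool × CTState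
  | [], f => (false, f)
  | (p, ht) :: rest, f =>
      match etInsertTop ht x (f p) with
      | (true, s') => (true, fun q => if q = p then s' else f q)
      | (false, s') => tryNodes x rest fun q => if q = p then s' else f q

/-- Insert `x` into a composite tree of height `H` with root label `I`: walk from the
unique admissible leaf up towards the root, inserting into the first elementary tree on
this path that accepts `x`. -/
def ctInsert (H : ℕ) (I : ℝ × ℝ) (x : ℝ) (f : CTState) : Bool × CTState :=
  tryNodes x (ctNodeSeq H I x) f

/-- The state of a tree ensemble: one composite tree `A` followed by elementary trees
`B 0, B 1, …` (of which only the first `α` are used in an ensemble of order `α`). -/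
structure EnsState where
  A : CTState
  B : ℕ → ETState

/-- The initial state of a tree ensemble with common root label `I`. -/
def ensInit (I : ℝ × ℝ) : EnsState := ⟨ctInit I, fun _ => ETState.init I⟩

/-- Try to insert `x` into the elementary trees `B j` for the listed indices `j`, in
order, stopping at the first success. -/
def tryBs (H : ℕ) (x : ℝ) : List ℕ → (ℕ → ETState) → Bool × (ℕ → ETState)
  | [], B => (false, B)
  | j :: rest, B =>
      match etInsertTop H x (B j) with
      | (true, s') => (true, fun i => if i = j then s' else B i)
      | (false, s') => tryBs H x rest fun i => if i = j then s' else B i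

/-- Insert `x` into a tree ensemble of order `α` (trees of height `H`, common root label
`I`): first try the composite tree `A`; if that fails, try `B 0, …, B (α-1)` in order. -/
def ensInsert (H α : ℕ) (I : ℝ × ℝ) (x : ℝ) (s : EnsState) : Bool × EnsState :=
  match ctInsert H I x s.A with
  | (true, A') => (true, ⟨A', s.B⟩)
  | (false, A') =>
      let r := tryBs H x (List.range α) s.B
      (r.1, ⟨A', r.2⟩)

/-- Insert the elements of `xs` one by one into a tree ensemble of order `α` with trees of
height `H` and common root label `I`, returning the conjunction of all success flags
together with the final state. -/
def ensRun (H α : ℕ) (I : ℝ × ℝ) (xs : List ℝ) : Bool × EnsState :=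
  xs.foldl (fun acc x =>
    let r := ensInsert H α I x acc.2
    (acc.1 && r.1, r.2)) (true, ensInit I)

/-- Insert the elements of `xs` one by one into a single composite tree of height `H`
with root label `I`. -/
def ctRun (H : ℕ) (I : ℝ × ℝ) (xs : List ℝ) : CTState :=
  xs.foldl (fun f x => (ctInsert H I x f).2) (ctInit I)


namespace S17

def IsHalf (L P : ℝ × ℝ) : Prop :=
  L = (P.1, (P.1 + P.2) / 2) ∨ L = ((P.1 + P.2) / 2, P.2)

def Mem (x : ℝ) (I : ℝ × ℝ) : Prop := I.1 ≤ x ∧ x < I.2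

def Valid (s : ETState) : Prop :=
  ∀ q b L, s.label (q ++ [b]) = some L → ∃ P, s.label q = some P ∧ IsHalf L P

def Ext (s s' : ETState) : Prop :=
  ∀ q L, s.label q = some L → s'.label q = some L

lemma isHalf_sub {L P : ℝ × ℝ} (h : IsHalf L P) {y : ℝ} (hy : Mem y L) : Mem y P := by
  unfold Mem at *
  rcases h with h | h <;> subst h <;> simp only at hy ⊢ <;> constructor <;> linarith [hy.1, hy.2]

lemma half_isHalf (I : ℝ × ℝ) (x : ℝ) : IsHalf (halfContaining I x) I := by
  unfold halfContaining IsHalf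
  split_ifs <;> simp

lemma half_mem {I : ℝ × ℝ} {x : ℝ} (h : Mem x I) : Mem x (halfContaining I x) := by
  unfold halfContaining Mem at *
  split_ifs with h1
  · exact ⟨h.1, h1⟩
  · exact ⟨not_lt.mp h1, h.2⟩

lemma Ext.refl (s : ETState) : Ext s s := fun _ _ h => h

lemma Ext.trans {s t u : ETState} (h : Ext s t) (h' : Ext t u) : Ext s u :=
  fun q L hq => h' q L (h q L hq)

lemma ext_setLabel {s : ETState} {p : List Bool} (I : ℝ × ℝ) (h : s.label p = none) :
    Ext s (s.setLabel p I) := by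
  intro q L hq
  simp only [ETState.setLabel]
  split_ifs with h1
  · subst h1; simp [h] at hq
  · exact hq

lemma valid_setLabel {s : ETState} {p : List Bool} {I pl : ℝ × ℝ} (hv : Valid s)
    (h : s.label p = none) (hI : IsHalf I pl)
    (hp : ∃ q b, p = q ++ [b] ∧ s.label q = some pl) : Valid (s.setLabel p I) := by
  obtain ⟨q0, b0, hq0, hl⟩ := hp
  intro q b L hL
  simp only [ETState.setLabel] at hL ⊢
  by_cases h1 : q ++ [b] = p
  · rw [if_pos h1] at hL
    have h2 : q = q0 := by
      rw [hq0] at h1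
      exact (List.append_inj' h1 rfl).1
    subst h2
    have h3 : q ≠ p := by rintro rfl; simp [h] at hl
    rw [if_neg h3]
    refine ⟨pl, hl, ?_⟩
    cases hL; exact hI
  · rw [if_neg h1] at hL
    obtain ⟨P, hP, hh⟩ := hv q b L hL
    have h3 : q ≠ p := by rintro rfl; simp [h] at hP
    rw [if_neg h3]
    exact ⟨P, hP, hh⟩

lemma valid_child_none {s : ETState} (hv : Valid s) {p : List Bool} (h : s.label p = none)
    (b : Bool) : s.label (p ++ [b]) = none := by
  cases hh : s.label (p ++ [b]) with
  | none => rfl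
  | some L =>
    obtain ⟨P, hP, _⟩ := hv p b L hh
    simp [h] at hP

/-- only children of `p` needed -/
lemma valid_desc_none {s : ETState} (hv : Valid s) {p : List Bool} (h : s.label p = none)
    (r : List Bool) : s.label (p ++ r) = none := by
  induction r using List.reverseRecOn with
  | nil => simpa using h
  | append_singleton r b ih =>
    rw [← List.append_assoc]; exact valid_child_none hv ih b

/-- inserting at an unmarked node -/
lemma unmarked (d : ℕ) : ∀ (p : List Bool) (pl : ℝ × ℝ) (x : ℝ) (s : ETState),
    (∀ r, s.label (p ++ r) = none) →
    (etInsert d p pl x s).1 = true ∧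
    (∀ q, (etInsert d p pl x s).2.label q ≠ s.label q →
      ∃ i ≤ d, q = p ++ List.replicate i false) ∧
    (∀ i ≤ d, (etInsert d p pl x s).2.label (p ++ List.replicate i false) ≠ none) ∧
    (Mem x pl → ∀ q L, (etInsert d p pl x s).2.label q = some L → s.label q = none →
      Mem x L) ∧
    (∀ q, (etInsert d p pl x s).2.occ q ≠ none → s.occ q ≠ none ∨
      q = p ++ List.replicate d false) ∧
    (Valid s → (∃ q b, p = q ++ [b] ∧ s.label q = some pl) →
      Valid (etInsert d p pl x s).2) := by
  induction d with
  | zero =>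
    intro p pl x s hn
    have h0 : s.label p = none := by simpa using hn []
    have he : etInsert 0 p pl x s
        = (true, (s.setLabel p (halfContaining pl x)).setOcc p x) := by
      simp [etInsert, h0]
    rw [he]
    refine ⟨rfl, ?_, ?_, ?_, ?_, ?_⟩
    · intro q hq
      refine ⟨0, le_rfl, ?_⟩
      by_contra hne
      simp at hne
      simp [ETState.setLabel, ETState.setOcc, hne] at hq
    · intro i hi
      have : i = 0 := by omega
      subst this
      simp [ETState.setLabel, ETState.setOcc]
    · intro hx q L hq hs
      simp only [ETState.setLabel, ETState.setOcc] at hq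
      split_ifs at hq with h1
      · cases hq; exact half_mem hx
      · simp [hs] at hq
    · intro q hq
      by_cases h1 : q = p
      · right; simp [h1]
      · left; simpa [ETState.setLabel, ETState.setOcc, h1] using hq
    · intro hv hp
      exact valid_setLabel hv h0 (half_isHalf pl x) hp
  | succ d ih =>
    intro p pl x s hn
    have h0 : s.label p = none := by simpa using hn []
    set I := halfContaining pl x with hI
    have he : etInsert (d+1) p pl x s
        = etInsert d (p ++ [false]) I x (s.setLabel p I) := by
      simp [etInsert, h0, hI]
    rw [he]
    have hn' : ∀ r, (s.setLabel p I).label (p ++ [false] ++ r) = none := by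
      intro r
      simp only [ETState.setLabel]
      rw [if_neg (by simp), List.append_assoc]
      exact hn _
    obtain ⟨a, b, c, dd, e, f⟩ := ih (p ++ [false]) I x (s.setLabel p I) hn'
    have rep : ∀ i, p ++ [false] ++ List.replicate i false = p ++ List.replicate (i+1) false := by
      intro i; simp [List.replicate_succ]
    have hpp : (etInsert d (p ++ [false]) I x (s.setLabel p I)).2.label p = some I := by
      by_contra hne
      have : (s.setLabel p I).label p = some I := by simp [ETState.setLabel]
      obtain ⟨i, _, hi⟩ := b p (by rw [this]; exact hne)
      rw [rep] at hi
      have := congrArg List.length hi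
      simp at this
    refine ⟨a, ?_, ?_, ?_, ?_, ?_⟩
    · intro q hq
      by_cases h1 : q = p
      · exact ⟨0, by omega, by simp [h1]⟩
      · obtain ⟨i, hi, hq'⟩ := b q (by simpa [ETState.setLabel, h1] using hq)
        exact ⟨i+1, by omega, by rw [hq', rep]⟩
    · intro i hi
      rcases i with _ | i
      · simp [hpp]
      · rw [← rep]; exact c i (by omega)
    · intro hx q L hq hs
      by_cases h1 : q = p
      · subst h1; rw [hpp] at hq; cases hq; exact half_mem hx
      · exact dd (half_mem hx) q L hq (by simpa [ETState.setLabel, h1] using hs)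
    · intro q hq
      rcases e q hq with h | h
      · left; exact h
      · right; rw [h, rep]
    · intro hv hp
      exact f (valid_setLabel hv h0 (half_isHalf pl x) hp)
        ⟨p, false, rfl, by simp [ETState.setLabel]⟩

/-- marked internal node: the three cases -/
lemma marked_eq {d : ℕ} {p : List Bool} {pl : ℝ × ℝ} {x : ℝ} {s : ETState} {I : ℝ × ℝ}
    (h : s.label p = some I) :
    etInsert (d+1) p pl x s = if Mem x I then
      (if (etInsert d (p ++ [false]) I x s).1 = true then etInsert d (p ++ [false]) I x s
       else etInsert d (p ++ [true]) I x (etInsert d (p ++ [false]) I x s).2)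
      else (false, s) := by
  unfold Mem
  simp only [etInsert, h]
  split_ifs with h1 h2
  · rcases hh : etInsert d (p ++ [false]) I x s with ⟨b, s'⟩
    rw [hh] at h2; simp only at h2; subst h2; rfl
  · rcases hh : etInsert d (p ++ [false]) I x s with ⟨b, s'⟩
    rw [hh] at h2; simp only [Bool.not_eq_true] at h2; subst h2; rfl
  · rfl

lemma fail_spec (d : ℕ) : ∀ (p : List Bool) (pl : ℝ × ℝ) (x : ℝ) (s : ETState), Valid s →
    (etInsert d p pl x s).1 = false →
    etInsert d p pl x s = (false, s) ∧ s.label p ≠ none := by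
  induction d with
  | zero =>
    intro p pl x s hv hf
    cases h : s.label p with
    | none => simp [etInsert, h] at hf
    | some I => simp [etInsert, h]
  | succ d ih =>
    intro p pl x s hv hf
    cases h : s.label p with
    | none =>
      have := (unmarked (d+1) p pl x s (valid_desc_none hv h)).1
      simp [this] at hf
    | some I =>
      refine ⟨?_, by simp⟩
      rw [marked_eq h] at hf ⊢
      split_ifs at hf ⊢ with h1 h2
      · simp [h2] at hf
      · have hl := (ih (p ++ [false]) I x s hv (by simpa using h2)).1
        rw [hl] at hf ⊢
        exact (ih (p ++ [true]) I x s hv hf).1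
      · rfl

structure Spec (d : ℕ) (p : List Bool) (x : ℝ) (s t : ETState) : Prop where
  ext : Ext s t
  valid : Valid t
  mem : ∀ q L, t.label q = some L → s.label q = none → Mem x L
  pre : ∀ q, t.label q ≠ none → s.label q = none → ∃ r, q = p ++ r ∧ r.length ≤ d
  spine : ∀ q, t.label q ≠ none → s.label q = none → q.length < p.length + d →
    t.label (q ++ [false]) ≠ none
  left : ∀ u v, t.label (p ++ u ++ true :: v) ≠ none → s.label (p ++ u ++ true :: v) = none →
    ∃ P, etInsert (d - u.length - 1) (p ++ u ++ [false]) P x s = (false, s)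
  uniq : ∀ q q', t.label q ≠ none → s.label q = none → t.label q' ≠ none → s.label q' = none →
    q.length = p.length + d → q'.length = p.length + d → q = q'
  occ : ∀ q, t.occ q ≠ none → s.occ q ≠ none ∨ (t.label q ≠ none ∧ q.length = p.length + d)

lemma Spec.rfl' {d p x s} (hv : Valid s) : Spec d p x s s where
  ext := Ext.refl s
  valid := hv
  mem := by intro q L h h'; simp [h] at h'
  pre := by intro q h h'; exact absurd h' h
  spine := by intro q h h'; exact absurd h' h
  left := by intro u v h h'; exact absurd h' h
  uniq := by intro q q' h h'; exact absurd h' h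
  occ := by intro q h; exact Or.inl h

lemma spec_child {d p x s t} (b : Bool) (hs : Spec d (p ++ [b]) x s t)
    (hb : b = true → ∃ P, etInsert d (p ++ [false]) P x s = (false, s)) :
    Spec (d+1) p x s t where
  ext := hs.ext
  valid := hs.valid
  mem := hs.mem
  pre := by
    intro q h h'
    obtain ⟨r, hr, hl⟩ := hs.pre q h h'
    exact ⟨b :: r, by simp [hr], by simp [hl]⟩
  spine := by
    intro q h h' hl
    exact hs.spine q h h' (by simp; omega)
  left := by
    intro u v h h'
    obtain ⟨r, hr, hl⟩ := hs.pre _ h h'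
    rcases u with _ | ⟨c, u⟩
    · simp at hr
      have hbt : b = true := hr.1
      simpa using hb hbt
    · simp at hr
      obtain ⟨rfl, hr⟩ := hr
      obtain ⟨P, hP⟩ := hs.left u v (by simpa using h) (by simpa using h')
      refine ⟨P, ?_⟩
      simpa using hP
  uniq := by
    intro q q' h1 h2 h3 h4 h5 h6
    exact hs.uniq q q' h1 h2 h3 h4 (by simp; omega) (by simp; omega)
  occ := by
    intro q h
    rcases hs.occ q h with h | ⟨h, h'⟩
    · exact Or.inl h
    · right; exact ⟨h, by simp at h'; omega⟩

lemma spec_main (d : ℕ) : ∀ (p : List Bool) (pl : ℝ × ℝ) (x : ℝ) (s : ETState), Valid s →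
    (s.label p = none → Mem x pl ∧ ∃ q b, p = q ++ [b] ∧ s.label q = some pl) →
    Spec d p x s (etInsert d p pl x s).2 := by
  have key : ∀ (d : ℕ) (p : List Bool) (pl : ℝ × ℝ) (x : ℝ) (s : ETState), Valid s →
    (s.label p = none → Mem x pl ∧ ∃ q b, p = q ++ [b] ∧ s.label q = some pl) →
    s.label p = none → Spec d p x s (etInsert d p pl x s).2 := by
    intro d p pl x s hv hp hn
    obtain ⟨hx, hpar⟩ := hp hn
    obtain ⟨a, b, c, dd, e, f⟩ := unmarked d p pl x s (valid_desc_none hv hn)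
    have nb : ∀ q, (etInsert d p pl x s).2.label q ≠ none → s.label q = none →
        ∃ i ≤ d, q = p ++ List.replicate i false := by
      intro q h h'
      exact b q (by rw [h']; exact h)
    refine ⟨?_, f hv hpar, dd hx, ?_, ?_, ?_, ?_, ?_⟩
    · intro q L hq
      by_contra hne
      obtain ⟨i, _, hi⟩ := b q (by rw [hq]; exact hne)
      rw [hi, valid_desc_none hv hn] at hq
      cases hq
    · intro q h h'
      obtain ⟨i, hi, hq⟩ := nb q h h'
      exact ⟨_, hq, by simpa using hi⟩
    · intro q h h' hl
      obtain ⟨i, hi, hq⟩ := nb q h h'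
      rw [hq] at hl
      simp at hl
      have := c (i+1) (by omega)
      rw [List.replicate_succ'] at this
      rw [hq, List.append_assoc]; exact this
    · intro u v h h'
      obtain ⟨i, hi, hq⟩ := nb _ h h'
      rw [List.append_assoc] at hq
      have hq := List.append_cancel_left hq
      have : true ∈ List.replicate i false := by rw [← hq]; simp
      simp at this
    · intro q q' h1 h2 h3 h4 h5 h6
      obtain ⟨i, hi, hq⟩ := nb _ h1 h2
      obtain ⟨j, hj, hq'⟩ := nb _ h3 h4
      subst hq hq'
      simp at h5 h6
      rw [h5, h6]
    · intro q h
      rcases e q h with h | h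
      · exact Or.inl h
      · right
        rw [h]
        exact ⟨c d le_rfl, by simp⟩
  induction d with
  | zero =>
    intro p pl x s hv hp
    cases h : s.label p with
    | none => exact key 0 p pl x s hv hp h
    | some I =>
      have : etInsert 0 p pl x s = (false, s) := by simp [etInsert, h]
      rw [this]; exact Spec.rfl' hv
  | succ d ih =>
    intro p pl x s hv hp
    cases h : s.label p with
    | none => exact key _ p pl x s hv hp h
    | some I =>
      rw [marked_eq h]
      split_ifs with h1 h2
      · exact spec_child false (ih _ I x s hv fun _ => ⟨h1, p, false, rfl, h⟩) (by simp)
      · have hl := (fail_spec d _ I x s hv (by simpa using h2)).1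
        rw [hl]
        exact spec_child true (ih _ I x s hv fun _ => ⟨h1, p, true, rfl, h⟩) fun _ => ⟨I, hl⟩
      · exact Spec.rfl' hv

/-- stuck for `J` -/
def Cl (J : ℝ × ℝ) (s : ETState) : ℕ → List Bool → Prop
  | 0, p => s.label p ≠ none ∧
      (s.label p = some J → s.label (p ++ [false]) ≠ none ∧ s.label (p ++ [true]) ≠ none)
  | j+1, p => ∃ P, s.label p = some P ∧
      ((∀ y, Mem y J → Mem y P) → Cl J s j (p ++ [false]) ∧ Cl J s j (p ++ [true]))

lemma Ext.ne {s t : ETState} (h : Ext s t) {q : List Bool} (hq : s.label q ≠ none) :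
    t.label q ≠ none := by
  cases hh : s.label q with
  | none => exact absurd hh hq
  | some L => rw [h q L hh]; simp

lemma Cl.mono {J : ℝ × ℝ} {s t : ETState} (h : Ext s t) : ∀ (j : ℕ) (p : List Bool),
    Cl J s j p → Cl J t j p := by
  intro j
  induction j with
  | zero =>
    rintro p ⟨h1, h2⟩
    refine ⟨h.ne h1, fun h3 => ?_⟩
    have : s.label p = some J := by
      cases hh : s.label p with
      | none => exact absurd hh h1
      | some L => rw [← h3, h _ _ hh]
    exact ⟨h.ne (h2 this).1, h.ne (h2 this).2⟩
  | succ j ih =>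
    rintro p ⟨P, h1, h2⟩
    exact ⟨P, h _ _ h1, fun h3 => ⟨ih _ (h2 h3).1, ih _ (h2 h3).2⟩⟩

lemma children_fail {d p pl x s I} (hv : Valid s) (h : s.label p = some I) (hx : Mem x I)
    (hf : (etInsert (d+1) p pl x s).1 = false) :
    (etInsert d (p ++ [false]) I x s).1 = false ∧ (etInsert d (p ++ [true]) I x s).1 = false := by
  rw [marked_eq h, if_pos hx] at hf
  split_ifs at hf with h2
  · simp [h2] at hf
  · have h2 : (etInsert d (p ++ [false]) I x s).1 = false := by simpa using h2
    refine ⟨h2, ?_⟩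
    rw [(fail_spec d _ I x s hv h2).1] at hf
    exact hf

lemma cl_of_fail {J : ℝ × ℝ} {x : ℝ} {s : ETState} (hv : Valid s) (hx : Mem x J) (k : ℕ) :
    ∀ (j : ℕ) (p : List Bool) (pl : ℝ × ℝ),
    (etInsert (k + 1 + j) p pl x s).1 = false → Cl J s j p := by
  intro j
  induction j with
  | zero =>
    intro p pl hf
    refine ⟨(fail_spec _ _ _ _ _ hv hf).2, fun h => ?_⟩
    obtain ⟨h1, h2⟩ := children_fail hv h hx hf
    exact ⟨(fail_spec _ _ _ _ _ hv h1).2, (fail_spec _ _ _ _ _ hv h2).2⟩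
  | succ j ih =>
    intro p pl hf
    cases h : s.label p with
    | none => exact absurd h (fail_spec _ _ _ _ _ hv hf).2
    | some P =>
      refine ⟨P, h, fun hJ => ?_⟩
      obtain ⟨h1, h2⟩ := children_fail (d := k + 1 + j) hv h (hJ x hx) hf
      exact ⟨ih _ _ h1, ih _ _ h2⟩

def R (J : ℝ × ℝ) (s : ETState) : ℕ → List Bool → ℕ
  | 0, p => if s.label p = some J then 1 else 0
  | j+1, p => R J s j (p ++ [false]) + R J s j (p ++ [true])

def E (J : ℝ × ℝ) (s : ETState) : ℕ → List Bool → ℕ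
  | 0, p => if s.label p = some J then
      (if s.label (p ++ [false]) ≠ none then 1 else 0)
      + (if s.label (p ++ [true]) ≠ none then 1 else 0) else 0
  | j+1, p => E J s j (p ++ [false]) + E J s j (p ++ [true])

def lh (J : ℝ × ℝ) : ℝ × ℝ := (J.1, (J.1 + J.2) / 2)
def rh (J : ℝ × ℝ) : ℝ × ℝ := ((J.1 + J.2) / 2, J.2)

lemma E_le {J : ℝ × ℝ} {s : ETState} (hv : Valid s) : ∀ (j : ℕ) (p : List Bool),
    E J s j p ≤ R (lh J) s (j+1) p + R (rh J) s (j+1) p := by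
  intro j
  induction j with
  | zero =>
    intro p
    have key : ∀ b, s.label p = some J → (if s.label (p ++ [b]) ≠ none then 1 else 0) ≤
        R (lh J) s 0 (p ++ [b]) + R (rh J) s 0 (p ++ [b]) := by
      intro b hJ
      cases h : s.label (p ++ [b]) with
      | none => simp
      | some L =>
        obtain ⟨P, hP, hh⟩ := hv _ _ _ h
        rw [hJ] at hP
        cases hP
        rcases hh with hh | hh
        · simp [R, h, lh, ← hh]
        · simp [R, h, rh, ← hh]
    show E J s 0 p ≤ (R (lh J) s 0 (p ++ [false]) + R (lh J) s 0 (p ++ [true])) +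
      (R (rh J) s 0 (p ++ [false]) + R (rh J) s 0 (p ++ [true]))
    by_cases hJ : s.label p = some J
    · have h1 := key false hJ
      have h2 := key true hJ
      simp only [E, if_pos hJ]
      omega
    · simp [E, hJ]
  | succ j ih =>
    intro p
    have h1 := ih (p ++ [false])
    have h2 := ih (p ++ [true])
    simp only [E]
    have e1 : R (lh J) s (j+1+1) p = R (lh J) s (j+1) (p ++ [false]) + R (lh J) s (j+1) (p ++ [true]) := rfl
    have e2 : R (rh J) s (j+1+1) p = R (rh J) s (j+1) (p ++ [false]) + R (rh J) s (j+1) (p ++ [true]) := rfl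
    omega

lemma R_pos {J : ℝ × ℝ} {s : ETState} : ∀ (j : ℕ) (p : List Bool), 0 < R J s j p →
    ∃ w, w.length = j ∧ s.label (p ++ w) = some J := by
  intro j
  induction j with
  | zero =>
    intro p h
    refine ⟨[], rfl, ?_⟩
    by_contra hne
    simp at hne
    simp [R, hne] at h
  | succ j ih =>
    intro p h
    simp only [R] at h
    by_cases h1 : 0 < R J s j (p ++ [false])
    · obtain ⟨w, hw, h⟩ := ih _ h1
      exact ⟨false :: w, by simp [hw], by simpa using h⟩
    · obtain ⟨w, hw, h⟩ := ih (p ++ [true]) (by omega)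
      exact ⟨true :: w, by simp [hw], by simpa using h⟩

lemma sub_anc {s : ETState} (hv : Valid s) (p : List Bool) : ∀ (w : List Bool) (J : ℝ × ℝ),
    s.label (p ++ w) = some J → ∃ P, s.label p = some P ∧ ∀ y, Mem y J → Mem y P := by
  intro w
  induction w using List.reverseRecOn with
  | nil => intro J h; exact ⟨J, by simpa using h, fun _ h => h⟩
  | append_singleton w b ih =>
    intro J h
    rw [← List.append_assoc] at h
    obtain ⟨Q, hQ, hh⟩ := hv _ _ _ h
    obtain ⟨P, hP, h3⟩ := ih Q hQ
    exact ⟨P, hP, fun y hy => h3 y (isHalf_sub hh hy)⟩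

lemma cl_bound {J : ℝ × ℝ} {s : ETState} (hv : Valid s) : ∀ (j : ℕ) (p : List Bool),
    Cl J s j p → 2 * R J s j p ≤ E J s j p := by
  intro j
  induction j with
  | zero =>
    rintro p ⟨h1, h2⟩
    by_cases h : s.label p = some J
    · have := h2 h
      simp [R, E, h, this.1, this.2]
    · simp [R, h]
  | succ j ih =>
    rintro p ⟨P, hP, h2⟩
    by_cases h : 0 < R J s (j+1) p
    · obtain ⟨w, _, hw⟩ := R_pos _ _ h
      obtain ⟨P', hP', hs⟩ := sub_anc hv p w J hw
      rw [hP] at hP'; cases hP'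
      have h3 := ih _ (h2 hs).1
      have h4 := ih _ (h2 hs).2
      simp only [R, E]; omega
    · omega

/-- invariant of one elementary tree of height `h` -/
structure TInv (h : ℕ) (s : ETState) : Prop where
  valid : Valid s
  spine : ∀ q, q ≠ [] → s.label q ≠ none → q.length < h → s.label (q ++ [false]) ≠ none
  occ : ∀ q, s.occ q ≠ none → s.label q ≠ none ∧ q.length = h
  ord : ∀ u w L, u.length + 1 + w.length < h → s.label (u ++ true :: w) = some L →
    Cl L s w.length (u ++ [false])

lemma good_bound {J : ℝ × ℝ} {s : ETState} {h : ℕ} (hi : TInv h s) : ∀ (j : ℕ) (p : List Bool),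
    0 < p.length + j → p.length + j < h → 2 * R J s j p ≤ E J s j p + 1 := by
  intro j
  induction j with
  | zero =>
    intro p h0 h1
    by_cases hl : s.label p = some J
    · have := hi.spine p (by rintro rfl; simp at h0) (by simp [hl]) (by omega)
      simp [R, E, hl, this]
    · simp [R, hl]
  | succ j ih =>
    intro p h0 h1
    have a := ih (p ++ [false]) (by simp) (by simp; omega)
    have b := ih (p ++ [true]) (by simp) (by simp; omega)
    simp only [R, E]
    by_cases hR : 0 < R J s j (p ++ [true])
    · obtain ⟨w, hw, hl⟩ := R_pos _ _ hR
      have := hi.ord p w J (by omega) (by simpa using hl)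
      rw [hw] at this
      have := cl_bound hi.valid _ _ this
      omega
    · omega

lemma R_le_of_noNew {J : ℝ × ℝ} {s t : ETState} : ∀ (j : ℕ) (p : List Bool),
    (∀ w, w.length = j → t.label (p ++ w) = some J → s.label (p ++ w) = some J) →
    R J t j p ≤ R J s j p := by
  intro j
  induction j with
  | zero =>
    intro p h
    have := h [] rfl
    simp only [List.append_nil] at this
    simp only [R]
    split_ifs <;> simp_all
  | succ j ih =>
    intro p h
    have a := ih (p ++ [false]) (fun w hw hl => by
      have := h (false :: w) (by simp [hw]) (by simpa using hl)
      simpa using this)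
    have b := ih (p ++ [true]) (fun w hw hl => by
      have := h (true :: w) (by simp [hw]) (by simpa using hl)
      simpa using this)
    simp only [R]; omega

lemma R_le_one {J : ℝ × ℝ} {s t : ETState} : ∀ (j : ℕ) (p : List Bool),
    (∀ w w', w.length = j → w'.length = j → t.label (p ++ w) = some J → s.label (p ++ w) ≠ some J →
      t.label (p ++ w') = some J → s.label (p ++ w') ≠ some J → w = w') →
    R J t j p ≤ R J s j p + 1 := by
  intro j
  induction j with
  | zero =>
    intro p h
    simp only [R]
    split_ifs <;> simp
  | succ j ih =>
    intro p h
    have c : ∀ b, ∀ w w', w.length = j → w'.length = j → t.label (p ++ [b] ++ w) = some J →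
        s.label (p ++ [b] ++ w) ≠ some J →
        t.label (p ++ [b] ++ w') = some J → s.label (p ++ [b] ++ w') ≠ some J → w = w' := by
      intro b w w' h1 h2 h3 h4 h5 h6
      have := h (b :: w) (b :: w') (by simp [h1]) (by simp [h2]) (by simpa using h3)
        (by simpa using h4) (by simpa using h5) (by simpa using h6)
      simpa using this
    have a := ih (p ++ [false]) (c false)
    have b := ih (p ++ [true]) (c true)
    simp only [R]
    by_cases hn : ∀ w, w.length = j → t.label (p ++ [false] ++ w) = some J →
        s.label (p ++ [false] ++ w) = some J
    · have := R_le_of_noNew j (p ++ [false]) hn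
      omega
    · push Not at hn
      obtain ⟨w, h1, h2, h3⟩ := hn
      have := R_le_of_noNew (J := J) (s := s) (t := t) j (p ++ [true]) (fun w' h4 h5 => by
        by_contra h6
        have := h (false :: w) (true :: w') (by simp [h1]) (by simp [h4]) (by simpa using h2)
          (by simpa using h3) (by simpa using h5) (by simpa using h6)
        simp at this)
      omega

lemma tinv_init (h : ℕ) (I : ℝ × ℝ) : TInv h (ETState.init I) where
  valid := by intro q b L hL; simp [ETState.init] at hL
  spine := by intro q hq hl; simp [ETState.init, hq] at hl
  occ := by intro q hq; simp [ETState.init] at hq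
  ord := by intro u w L _ hl; simp [ETState.init] at hl

/-- the elementary invariant is preserved -/
lemma tinv_step {h : ℕ} {s t : ETState} {x : ℝ} (hi : TInv h s)
    (sp : Spec h [] x s t) : TInv h t where
  valid := sp.valid
  spine := by
    intro q hq hl hlen
    by_cases hs : s.label q = none
    · exact sp.spine q hl hs (by simpa using hlen)
    · exact sp.ext.ne (hi.spine q hq hs hlen)
  occ := by
    intro q hq
    rcases sp.occ q hq with h1 | h1
    · exact ⟨sp.ext.ne (hi.occ q h1).1, (hi.occ q h1).2⟩
    · simpa using h1
  ord := by
    intro u w L hlen hl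
    cases hs : s.label (u ++ true :: w) with
    | some L' =>
      have := sp.ext _ _ hs
      rw [hl] at this; cases this
      exact (hi.ord u w L hlen hs).mono sp.ext
    | none =>
      obtain ⟨P, hP⟩ := sp.left u w (by simp [hl]) (by simpa using hs)
      have hx := sp.mem _ _ hl hs
      have e : h - u.length - 1 = (h - u.length - 1 - w.length - 1) + 1 + w.length := by omega
      rw [e] at hP
      exact (cl_of_fail hi.valid hx _ _ _ P (by simpa using congrArg Prod.fst hP)).mono sp.ext

lemma staticLabel_append (I : ℝ × ℝ) (p q : List Bool) :
    staticLabel I (p ++ q) = staticLabel (staticLabel I p) q := by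
  induction p generalizing I with
  | nil => rfl
  | cons b p ih => simp only [List.cons_append, staticLabel]; exact ih _

lemma staticLabel_sub (p : List Bool) : ∀ (I : ℝ × ℝ) (y : ℝ),
    Mem y (staticLabel I p) → Mem y I := by
  induction p with
  | nil => intro I y h; exact h
  | cons b p ih =>
    intro I y h
    have := ih _ y h
    refine isHalf_sub ?_ this
    unfold IsHalf
    cases b <;> simp

lemma descend_take (x : ℝ) (p : List Bool) : ∀ (I : ℝ × ℝ) (d : ℕ), p.length ≤ d →
    Mem x (staticLabel I p) → (descend x I d).take p.length = p := by
  induction p with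
  | nil => intro I d _ _; simp
  | cons b p ih =>
    intro I d hd hx
    obtain ⟨d, rfl⟩ : ∃ d', d = d' + 1 := ⟨d - 1, by simp at hd; omega⟩
    have hx' : Mem x (staticLabel (if b then ((I.1 + I.2) / 2, I.2) else (I.1, (I.1 + I.2) / 2)) p) := hx
    have hm := staticLabel_sub p _ x hx'
    have hd' : p.length ≤ d := by simpa using hd
    cases b with
    | false =>
      simp at hm hx'
      have h1 : x < (I.1 + I.2) / 2 := hm.2
      simp only [descend, if_pos h1, List.length_cons, List.take_succ_cons]
      rw [ih _ d hd' hx']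
    | true =>
      simp at hm hx'
      have h1 : ¬ x < (I.1 + I.2) / 2 := not_lt.mpr hm.1
      simp only [descend, if_neg h1, List.length_cons, List.take_succ_cons]
      rw [ih _ d hd' hx']

lemma descend_length (x : ℝ) (d : ℕ) : ∀ I, (descend x I d).length = d := by
  induction d with
  | zero => intro I; rfl
  | succ d ih =>
    intro I
    simp only [descend]
    split_ifs <;> simp [ih]

lemma tryNodes_spec (x : ℝ) (f : CTState) : ∀ (l : List (List Bool × ℕ)),
    (∀ a ∈ l, (etInsertTop a.2 x (f a.1)).1 = false →
      etInsertTop a.2 x (f a.1) = (false, f a.1)) →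
    (tryNodes x l f).2 = f ∨ ∃ i, ∃ hi : i < l.length,
      (tryNodes x l f).2 = (fun q => if q = l[i].1 then (etInsertTop l[i].2 x (f l[i].1)).2 else f q) ∧
      ∀ i', ∀ hi' : i' < i, (etInsertTop (l[i']).2 x (f (l[i']).1)).1 = false := by
  intro l
  induction l with
  | nil => intro _; left; rfl
  | cons a l ih =>
    intro h
    obtain ⟨p, ht⟩ := a
    have h0 := h (p, ht) (by simp)
    simp only at h0
    cases hb : (etInsertTop ht x (f p)).1 with
    | true =>
      right
      refine ⟨0, by simp, ?_, by simp⟩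
      rcases hr : etInsertTop ht x (f p) with ⟨b, s'⟩
      rw [hr] at hb
      simp only at hb
      subst hb
      simp [tryNodes, hr]
      first | rfl | (funext q; split_ifs <;> rfl)
    | false =>
      have hr := h0 hb
      have hf : (fun q => if q = p then f p else f q) = f := by
        funext q
        split_ifs with h1
        · rw [h1]
        · rfl
      have he : tryNodes x ((p, ht) :: l) f = tryNodes x l f := by
        simp only [tryNodes, hr]
        rw [hf]
      rw [he]
      rcases ih (fun a ha => h a (by simp [ha])) with h1 | ⟨i, hi, h1, h2⟩
      · exact Or.inl h1
      · right
        refine ⟨i + 1, by simpa using hi, by simpa using h1, ?_⟩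
        intro i' hi'
        rcases i' with _ | i'
        · simpa using hb
        · simpa using h2 i' (by omega)

structure CInv (H : ℕ) (I₀ : ℝ × ℝ) (C : CTState) : Prop where
  root : ∀ v, (C v).label [] = some (staticLabel I₀ v)
  tree : ∀ v, v.length < H → TInv (H - v.length) (C v)
  comp : ∀ (p : List Bool) (n : ℕ) (w : List Bool), p.length < H → n < p.length →
    w.length = p.length - n → (C (p.take n)).label w = some (staticLabel I₀ p) →
    ∀ m, n < m → m ≤ p.length → Cl (staticLabel I₀ p) (C (p.take m)) (p.length - m) []

lemma top_fail {h : ℕ} {x : ℝ} {s : ETState} (hi : Valid s)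
    (hf : (etInsertTop h x s).1 = false) : etInsertTop h x s = (false, s) :=
  (fail_spec h [] _ x s hi hf).1

lemma top_spec {h : ℕ} {x : ℝ} {s : ETState} (hi : Valid s) (h0 : s.label [] ≠ none) :
    Spec h [] x s (etInsertTop h x s).2 :=
  spec_main h [] _ x s hi (fun h => absurd h h0)

lemma ct_spec {H : ℕ} {I₀ : ℝ × ℝ} {C : CTState} (hC : CInv H I₀ C) (x : ℝ) :
    (ctInsert H I₀ x C).2 = C ∨ ∃ n < H, 
      (ctInsert H I₀ x C).2 = (fun q => if q = (descend x I₀ (H-1)).take n then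
        (etInsertTop (H - n) x (C q)).2 else C q) ∧
      ∀ m, n < m → m < H →
        (etInsertTop (H - m) x (C ((descend x I₀ (H-1)).take m))).1 = false := by
  have hlen := descend_length x (H-1) I₀
  have hpre : ∀ a ∈ ctNodeSeq H I₀ x, (etInsertTop a.2 x (C a.1)).1 = false →
      etInsertTop a.2 x (C a.1) = (false, C a.1) := by
    intro a ha hf
    simp only [ctNodeSeq, List.mem_map, List.mem_range] at ha
    obtain ⟨i, hi, rfl⟩ := ha
    refine top_fail (hC.tree _ ?_).valid hf
    simp [hlen]; omega
  rcases tryNodes_spec x C (ctNodeSeq H I₀ x) hpre with h | ⟨i, hi, h1, h2⟩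
  · exact Or.inl h
  · right
    have hi' : i < H := by simpa [ctNodeSeq] using hi
    refine ⟨H - 1 - i, by omega, ?_, ?_⟩
    · unfold ctInsert
      rw [h1]
      funext q
      simp only [ctNodeSeq, List.getElem_map, List.getElem_range]
      split_ifs with hq
      · rw [← hq]
        have : H - (H - 1 - i) = i + 1 := by omega
        rw [this]
      · rfl
    · intro m hm hmH
      have := h2 (H - 1 - m) (by omega)
      simp only [ctNodeSeq, List.getElem_map, List.getElem_range] at this
      have e1 : H - 1 - (H - 1 - m) = m := by omega
      have e2 : H - 1 - m + 1 = H - m := by omega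
      rw [e1, e2] at this
      exact this

/-- combined description of one step -/
lemma ct_step {H : ℕ} {I₀ : ℝ × ℝ} {C : CTState} (hC : CInv H I₀ C) (x : ℝ) :
    ∃ n, (∀ q, (ctInsert H I₀ x C).2 q = C q ∨
        (q.length = n ∧ n < H ∧ Spec (H - n) [] x (C q) ((ctInsert H I₀ x C).2 q))) ∧
      (∀ m, n < m → m < H →
        (etInsertTop (H - m) x (C ((descend x I₀ (H-1)).take m))).1 = false) := by
  rcases ct_spec hC x with h | ⟨n, hn, h1, h2⟩
  · exact ⟨H, fun q => Or.inl (by rw [h]), fun m h1 h2 => by omega⟩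
  · refine ⟨n, fun q => ?_, h2⟩
    rw [h1]
    simp only
    split_ifs with hq
    · right
      have hl : q.length = n := by
        rw [hq]; simp [descend_length]; omega
      refine ⟨hl, hn, ?_⟩
      exact top_spec (hC.tree q (by omega)).valid (by rw [hC.root]; simp)
    · exact Or.inl rfl

lemma ct_ext {H : ℕ} {I₀ : ℝ × ℝ} {C : CTState} (hC : CInv H I₀ C) (x : ℝ) (q : List Bool) :
    Ext (C q) ((ctInsert H I₀ x C).2 q) := by
  obtain ⟨n, h1, _⟩ := ct_step hC x
  rcases h1 q with h | ⟨_, _, h⟩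
  · rw [h]; exact Ext.refl _
  · exact h.ext

lemma cinv_init (H : ℕ) (I₀ : ℝ × ℝ) : CInv H I₀ (ctInit I₀) where
  root := by intro v; simp [ctInit, ETState.init]
  tree := by intro v _; exact tinv_init _ _
  comp := by
    intro p n w h1 h2 h3 h4
    have : w ≠ [] := by rintro rfl; simp at h3; omega
    simp [ctInit, ETState.init, this] at h4

lemma cinv_step {H : ℕ} {I₀ : ℝ × ℝ} {C : CTState} (hC : CInv H I₀ C) (x : ℝ) :
    CInv H I₀ (ctInsert H I₀ x C).2 where
  root := by intro v; exact ct_ext hC x v _ _ (hC.root v)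
  tree := by
    intro v hv
    obtain ⟨n, h1, _⟩ := ct_step hC x
    rcases h1 v with h | ⟨hl, _, h⟩
    · rw [h]; exact hC.tree v hv
    · subst hl
      exact tinv_step (hC.tree v hv) h
  comp := by
    intro p n w hp hn hw hl m hm hmp
    refine Cl.mono (ct_ext hC x _) _ _ ?_
    cases hs : (C (p.take n)).label w with
    | some L =>
      have := ct_ext hC x _ _ _ hs
      rw [hl] at this
      cases this
      exact hC.comp p n w hp hn hw hs m hm hmp
    | none =>
      obtain ⟨n', h1, h2⟩ := ct_step hC x
      rcases h1 (p.take n) with h | ⟨hl', hnH, h⟩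
      · rw [h, hs] at hl; cases hl
      · have e : n' = n := by rw [← hl']; simp; omega
        subst e
        have hx := h.mem _ _ hl hs
        have hd := descend_take x p I₀ (H-1) (by omega) hx
        have hf := h2 m hm (by omega)
        have ht : (descend x I₀ (H-1)).take m = p.take m := by
          conv_rhs => rw [← hd]
          rw [List.take_take, min_eq_left hmp]
        rw [ht] at hf
        have e2 : H - m = (H - p.length - 1) + 1 + (p.length - m) := by omega
        rw [e2] at hf
        exact cl_of_fail (hC.tree (p.take m) (by simp; omega)).valid hx _ _ _ _ hf

def N (xs : List ℝ) (J : ℝ × ℝ) : ℕ := xs.countP fun x => decide (Mem x J)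

def RS (I₀ : ℝ × ℝ) (C : CTState) (p : List Bool) : ℕ :=
  ∑ n ∈ Finset.range p.length, R (staticLabel I₀ p) (C (p.take n)) (p.length - n) []

lemma R_init (J I : ℝ × ℝ) (j : ℕ) (p : List Bool) (h : 0 < p.length + j) :
    R J (ETState.init I) j p = 0 := by
  by_contra hne
  obtain ⟨w, hw, hl⟩ := R_pos _ _ (Nat.pos_of_ne_zero hne)
  have : p ++ w ≠ [] := by
    intro h'
    have := congrArg List.length h'
    simp [hw] at this
    simp [this] at h
  simp only [ETState.init, if_neg this] at hl
  cases hl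

lemma run_inv (H : ℕ) (I₀ : ℝ × ℝ) (xs : List ℝ) :
    CInv H I₀ (ctRun H I₀ xs) ∧
    ∀ p, p.length = H → RS I₀ (ctRun H I₀ xs) p ≤ N xs (staticLabel I₀ p) := by
  induction xs using List.reverseRecOn with
  | nil =>
    refine ⟨cinv_init H I₀, fun p hp => ?_⟩
    have : RS I₀ (ctRun H I₀ []) p = 0 := by
      unfold RS
      refine Finset.sum_eq_zero fun n hn => ?_
      exact R_init _ _ _ _ (by simp at hn; simp; omega)
    omega
  | append_singleton xs x ih =>
    obtain ⟨hC, hleaf⟩ := ih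
    have e : ctRun H I₀ (xs ++ [x]) = (ctInsert H I₀ x (ctRun H I₀ xs)).2 := by
      simp [ctRun, List.foldl_append]
    rw [e]
    refine ⟨cinv_step hC x, fun p hp => ?_⟩
    set C := ctRun H I₀ xs with hCdef
    have h0 := hleaf p hp
    obtain ⟨n, h1, _⟩ := ct_step hC x
    set C' := (ctInsert H I₀ x C).2 with hC'
    set J := staticLabel I₀ p with hJ
    by_cases hx : Mem x J
    · have hN : N (xs ++ [x]) J = N xs J + 1 := by
        simp [N, List.countP_append, hx]
      rw [hN]
      have : RS I₀ C' p ≤ ∑ m ∈ Finset.range p.length,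
          (R J (C (p.take m)) (p.length - m) [] + if m = n then 1 else 0) := by
        refine Finset.sum_le_sum fun m hm => ?_
        simp only [Finset.mem_range] at hm
        rcases h1 (p.take m) with h | ⟨hl, hnH, h⟩
        · rw [h]; exact Nat.le_add_right _ _
        · have em : m = n := by rw [← hl]; simp; omega
          subst em
          rw [if_pos rfl]
          refine R_le_one _ _ fun w w' a1 a2 a3 a4 a5 a6 => ?_
          simp only [List.nil_append] at a3 a4 a5 a6
          have none_of : ∀ z, (C' (p.take m)).label z = some J → (C (p.take m)).label z ≠ some J →
              (C (p.take m)).label z = none := by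
            intro z b1 b2
            cases hz : (C (p.take m)).label z with
            | none => rfl
            | some L =>
              have := h.ext _ _ hz
              rw [b1] at this; cases this; exact absurd hz b2
          exact h.uniq w w' (by rw [a3]; simp) (none_of _ a3 a4) (by rw [a5]; simp) (none_of _ a5 a6)
            (by simp [a1, hp]) (by simp [a2, hp])
      rw [Finset.sum_add_distrib] at this
      have h3 : (∑ m ∈ Finset.range p.length, if m = n then 1 else 0) ≤ 1 := by
        rw [Finset.sum_ite_eq']
        split_ifs <;> simp
      have h4 : RS I₀ C p = ∑ m ∈ Finset.range p.length, R J (C (p.take m)) (p.length - m) [] := rfl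
      omega
    · have hN : N (xs ++ [x]) J = N xs J := by
        simp [N, List.countP_append, hx]
      rw [hN]
      refine le_trans (Finset.sum_le_sum fun m hm => ?_) h0
      refine R_le_of_noNew _ _ fun w hw hl => ?_
      simp only [List.nil_append] at hl ⊢
      rcases h1 (p.take m) with h | ⟨_, _, h⟩
      · rw [h] at hl; exact hl
      · cases hz : (C (p.take m)).label w with
        | none => exact absurd (h.mem _ _ hl hz) hx
        | some L =>
          have := h.ext _ _ hz
          rw [hl] at this; exact this.symm

lemma staticLabel_false (I : ℝ × ℝ) (p : List Bool) :
    staticLabel I (p ++ [false]) = lh (staticLabel I p) := by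
  rw [staticLabel_append]; rfl

lemma staticLabel_true (I : ℝ × ℝ) (p : List Bool) :
    staticLabel I (p ++ [true]) = rh (staticLabel I p) := by
  rw [staticLabel_append]; rfl

lemma N_split (xs : List ℝ) (J : ℝ × ℝ) : N xs (lh J) + N xs (rh J) ≤ N xs J := by
  induction xs with
  | nil => simp [N]
  | cons x xs ih =>
    simp only [N, List.countP_cons] at ih ⊢
    have h1 : Mem x (lh J) → Mem x J := isHalf_sub (Or.inl rfl)
    have h2 : Mem x (rh J) → Mem x J := isHalf_sub (Or.inr rfl)
    have h3 : Mem x (lh J) → ¬ Mem x (rh J) := by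
      intro a b
      exact absurd a.2 (not_lt.mpr b.1)
    by_cases a : Mem x (lh J)
    · have := h3 a; have := h1 a; simp_all; omega
    · by_cases b : Mem x (rh J)
      · have := h2 b; simp_all; omega
      · simp_all; omega

lemma RS_children {H : ℕ} {I₀ : ℝ × ℝ} {C : CTState} (hC : CInv H I₀ C) (p : List Bool)
    (hp : p.length < H) :
    ∑ n ∈ Finset.range (p.length + 1), E (staticLabel I₀ p) (C (p.take n)) (p.length - n) []
      ≤ RS I₀ C (p ++ [false]) + RS I₀ C (p ++ [true]) := by
  unfold RS
  simp only [List.length_append, List.length_singleton]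
  rw [← Finset.sum_add_distrib]
  refine Finset.sum_le_sum fun n hn => ?_
  simp only [Finset.mem_range] at hn
  have hn' : n ≤ p.length := by omega
  rw [List.take_append_of_le_length hn', List.take_append_of_le_length hn',
    staticLabel_false, staticLabel_true]
  have e : p.length + 1 - n = (p.length - n) + 1 := by omega
  rw [e]
  exact E_le (hC.tree _ (by simp; omega)).valid _ _

lemma RS_double {H : ℕ} {I₀ : ℝ × ℝ} {C : CTState} (hC : CInv H I₀ C) (p : List Bool)
    (hp : p.length < H) (hpos : 0 < RS I₀ C p) :
    2 * RS I₀ C p + 1 ≤ RS I₀ C (p ++ [false]) + RS I₀ C (p ++ [true]) := by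
  refine le_trans ?_ (RS_children hC p hp)
  set J := staticLabel I₀ p with hJ
  have hex : ∃ n, n < p.length ∧ 0 < R J (C (p.take n)) (p.length - n) [] := by
    by_contra hno
    push Not at hno
    have : RS I₀ C p = 0 := Finset.sum_eq_zero fun n hn => by
      exact Nat.le_zero.mp (hno n (by simpa using hn))
    omega
  classical
  set k := Nat.find hex with hk
  obtain ⟨hkl, hkR⟩ := Nat.find_spec hex
  have hmin : ∀ n < k, R J (C (p.take n)) (p.length - n) [] = 0 := by
    intro n hn
    have := Nat.find_min hex hn
    push Not at this
    have := this (by omega)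
    omega
  obtain ⟨w, hw, hwl⟩ := R_pos _ _ hkR
  have hcl := hC.comp p k w hp hkl hw (by simpa using hwl)
  have hroot : 2 ≤ E J (C (p.take p.length)) (p.length - p.length) [] := by
    have := hcl p.length hkl le_rfl
    have hb := cl_bound (hC.tree (p.take p.length) (by simpa using hp)).valid _ _ this
    have hr : R J (C (p.take p.length)) (p.length - p.length) [] = 1 := by
      have h0 := hC.root p
      simp [R, h0, hJ]
    rw [hr] at hb
    exact hb
  rw [Finset.sum_range_succ]
  have hterm : ∑ n ∈ Finset.range p.length, 2 * R J (C (p.take n)) (p.length - n) [] ≤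
      ∑ n ∈ Finset.range p.length, (E J (C (p.take n)) (p.length - n) [] + if n = k then 1 else 0) := by
    refine Finset.sum_le_sum fun n hn => ?_
    simp only [Finset.mem_range] at hn
    have hlt : (p.take n).length = n := by simp; omega
    have hT := hC.tree (p.take n) (by omega)
    rcases lt_trichotomy n k with h | h | h
    · rw [hmin n h]; omega
    · rw [if_pos h]
      exact good_bound hT _ _ (by simp; omega) (by rw [hlt]; simp; omega)
    · have := cl_bound hT.valid _ _ (hcl n h (by omega))
      exact le_trans this (Nat.le_add_right _ _)
  rw [Finset.sum_add_distrib, ← Finset.mul_sum] at hterm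
  have h3 : (∑ m ∈ Finset.range p.length, if m = k then 1 else 0) ≤ 1 := by
    rw [Finset.sum_ite_eq']
    split_ifs <;> simp
  have h4 : RS I₀ C p = ∑ m ∈ Finset.range p.length, R J (C (p.take m)) (p.length - m) [] := rfl
  omega

lemma main_bound {H : ℕ} {I₀ : ℝ × ℝ} {C : CTState} (hC : CInv H I₀ C) (xs : List ℝ)
    (hleaf : ∀ p, p.length = H → RS I₀ C p ≤ N xs (staticLabel I₀ p)) :
    ∀ (k : ℕ) (p : List Bool), p.length + k = H →
      2 ^ k * RS I₀ C p ≤ N xs (staticLabel I₀ p) := by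
  intro k
  induction k with
  | zero => intro p hp; simpa using hleaf p (by simpa using hp)
  | succ k ih =>
    intro p hp
    have a := ih (p ++ [false]) (by simp; omega)
    have b := ih (p ++ [true]) (by simp; omega)
    rw [staticLabel_false] at a
    rw [staticLabel_true] at b
    have c := N_split xs (staticLabel I₀ p)
    rcases Nat.eq_zero_or_pos (RS I₀ C p) with h | h
    · rw [h]; simp
    · have d := RS_double hC p (by omega) h
      calc 2 ^ (k+1) * RS I₀ C p = 2 ^ k * (2 * RS I₀ C p) := by ring
        _ ≤ 2 ^ k * (RS I₀ C (p ++ [false]) + RS I₀ C (p ++ [true])) :=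
          Nat.mul_le_mul_left _ (by omega)
        _ ≤ _ := by rw [mul_add]; omega

lemma R_one_pos {J : ℝ × ℝ} {s : ETState} {b : Bool} (h : s.label [b] = some J) :
    0 < R J s 1 [] := by
  cases b <;> simp [R, h]

lemma final (H h : ℕ) (hh : 2 ≤ h) (I₀ : ℝ × ℝ)
    (xs : List ℝ) (p : List Bool) (hp : p.length + h = H)
    (hne : ∃ q : List Bool, (ctRun H I₀ xs p).occ q ≠ none) :
    2 ^ (h - 1) + 1 ≤ N xs (staticLabel I₀ p) := by
  obtain ⟨hC, hleaf⟩ := run_inv H I₀ xs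
  set C := ctRun H I₀ xs
  obtain ⟨q, hq⟩ := hne
  have hT := hC.tree p (by omega)
  obtain ⟨hql, hqlen⟩ := hT.occ q hq
  obtain ⟨b, q', rfl⟩ : ∃ b q', q = b :: q' := by
    cases q with
    | nil => simp at hqlen; omega
    | cons b q' => exact ⟨b, q', rfl⟩
  cases hbq : (C p).label (b :: q') with
  | none => exact absurd hbq hql
  | some L =>
  obtain ⟨J, hJ, _⟩ := sub_anc hT.valid [b] q' L (by simpa using hbq)
  obtain ⟨P, hP, hhalf⟩ := hT.valid [] b J (by simpa using hJ)
  rw [hC.root p] at hP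
  cases hP
  have key : ∀ c : Bool, J = staticLabel I₀ (p ++ [c]) →
      2 ^ (h - 1) + 1 ≤ N xs (staticLabel I₀ (p ++ [c])) := by
    intro c hc
    have hpos : 0 < RS I₀ C (p ++ [c]) := by
      have h1 : 0 < R (staticLabel I₀ (p ++ [c])) (C ((p ++ [c]).take p.length))
          ((p ++ [c]).length - p.length) [] := by
        have e : (p ++ [c]).length - p.length = 1 := by simp
        rw [e, List.take_left, ← hc]
        exact R_one_pos hJ
      refine lt_of_lt_of_le h1 ?_
      exact Finset.single_le_sum (f := fun n => R (staticLabel I₀ (p ++ [c]))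
        (C ((p ++ [c]).take n)) ((p ++ [c]).length - n) []) (fun _ _ => Nat.zero_le _) (by simp)
    have d := RS_double hC (p ++ [c]) (by simp; omega) hpos
    have a := main_bound hC xs hleaf (h - 2) (p ++ [c] ++ [false]) (by simp; omega)
    have b := main_bound hC xs hleaf (h - 2) (p ++ [c] ++ [true]) (by simp; omega)
    rw [staticLabel_false] at a
    rw [staticLabel_true] at b
    have e := N_split xs (staticLabel I₀ (p ++ [c]))
    have f : 2 ^ (h - 2) * 3 ≤ 2 ^ (h - 2) *
        (RS I₀ C (p ++ [c] ++ [false]) + RS I₀ C (p ++ [c] ++ [true])) :=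
      Nat.mul_le_mul_left _ (by omega)
    rw [mul_add] at f
    have g : 2 ^ (h - 1) = 2 * 2 ^ (h - 2) := by
      rw [← pow_succ']; congr 1; omega
    have i : 1 ≤ 2 ^ (h - 2) := Nat.one_le_two_pow
    omega
  have sp := N_split xs (staticLabel I₀ p)
  rcases hhalf with h1 | h1
  · have := key false (by rw [staticLabel_false]; exact h1)
    rw [staticLabel_false] at this
    omega
  · have := key true (by rw [staticLabel_true]; exact h1)
    rw [staticLabel_true] at this
    omega

end S17

/-!
STATEMENT 17: consider a sequence `xs` of elements inserted into a single composite tree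
of height `H` with root label `I₀`.  If the elementary tree representing a node `v` of the
composite tree at height `h ≥ 2` (path `p`, so `p.length + h = H`) with interval label
`I = staticLabel I₀ p` is non-empty, then at least `2 ^ (h-1) + 1` of the inserted
elements lie in `I`.
-/
theorem statement17 (H h : ℕ) (hh : 2 ≤ h) (I₀ : ℝ × ℝ) (hI₀ : I₀.1 < I₀.2)
    (xs : List ℝ) (hxs : ∀ x ∈ xs, x ∈ Set.Ico I₀.1 I₀.2)
    (p : List Bool) (hp : p.length + h = H)
    (hne : ∃ q : List Bool, (ctRun H I₀ xs p).occ q ≠ none) :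
    2 ^ (h - 1) + 1 ≤ xs.countP fun x =>
      decide ((staticLabel I₀ p).1 ≤ x ∧ x < (staticLabel I₀ p).2) := by
  have := S17.final H h hh I₀ xs p hp hne
  unfold S17.N S17.Mem at this
  convert this using 3
  congr
end
end
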